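/- arXiv:2307.04126 — 2 statements merged into one kernel-verified Lean document; each statement's English description precedes it below -/
import Mathlib

section
/- Let f be a smooth positive function on the round S² satisfying Δf ≤ f and ∫_{S²} f dvol ≤ V/(2π) for some constant V > 0. Then for every p ∈ [1, ∞), ∫_{S²} f^p dvol ≤ 4π exp(Vp/(8π²) + p²/4). -/
open Real MeasureTheory intervalIntegral

/- We work on the unit round sphere `S²` in geodesic polar coordinates `(r, θ)` centered at a
point `p`.  A smooth function `f` on `S²` is represented by `F : ℝ → ℝ → ℝ`, which is smooth,
`2π`-periodic in `θ`, and constant in `θ` at the poles `r = 0, π`. -/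

/-- The Laplace–Beltrami operator on the round `S²` (trace of the Hessian, no negative sign),
in geodesic polar coordinates. -/
noncomputable def sphLap (F : ℝ → ℝ → ℝ) (r θ : ℝ) : ℝ :=
  deriv (fun s => deriv (fun s' => F s' θ) s) r
    + (Real.cos r / Real.sin r) * deriv (fun s => F s θ) r
    + (1 / Real.sin r ^ 2) * deriv (deriv (F r)) θ

/-- The spherical mean `⨍_{∂B_r(p)} f ds = (∫_0^{2π} F(r,θ) dθ) / (2π)` (the circle `∂B_r(p)`
has length `2π sin r` and line element `sin r dθ`). -/
noncomputable def circleAvg (F : ℝ → ℝ → ℝ) (r : ℝ) : ℝ :=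
  (∫ θ in (0:ℝ)..(2*π), F r θ) / (2*π)

/-- The integral of a function over `S²` with the round area element `sin r dr dθ`. -/
noncomputable def sphereIntegral (G : ℝ → ℝ → ℝ) : ℝ :=
  ∫ r in (0:ℝ)..π, ∫ θ in (0:ℝ)..(2*π), G r θ * Real.sin r

/-- The `L²(S²)` norm of a function. -/
noncomputable def sphereL2 (F : ℝ → ℝ → ℝ) : ℝ :=
  Real.sqrt (sphereIntegral (fun r θ => (F r θ)^2))


/-- one-dimensional trapezoid inequality on a meridian -/
lemma merid_ineq (v v' : ℝ → ℝ) (hv : ∀ r, HasDerivAt v (v' r) r) (hv' : Continuous v')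
    (h0 : ∀ r, 0 ≤ v r) :
    ∫ r in (0:ℝ)..π, v r ^ 2 * sin r ≤
      (1/2) * (∫ r in (0:ℝ)..π, v r) *
        ((∫ r in (0:ℝ)..π, |v' r| * sin r) + ∫ r in (0:ℝ)..π, v r * sin r) := by
  have hvc : Continuous v := continuous_iff_continuousAt.2 fun r => (hv r).continuousAt
  set N : ℝ → ℝ := fun r => ∫ s in (0:ℝ)..r, v s with hN
  have hNd : ∀ r, HasDerivAt N (v r) r := fun r =>
    intervalIntegral.integral_hasDerivAt_right (hvc.intervalIntegrable _ _)
      hvc.aestronglyMeasurable.stronglyMeasurableAtFilter hvc.continuousAt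
  have hNc : Continuous N := continuous_iff_continuousAt.2 fun r => (hNd r).continuousAt
  set W := N π with hW
  have hN0 : N 0 = 0 := by simp [hN]
  have hNmono : Monotone N := monotone_of_deriv_nonneg (fun r => (hNd r).differentiableAt)
    (fun r => by rw [(hNd r).deriv]; exact h0 r)
  set C := ∫ s in (0:ℝ)..π, v s * cos s with hC
  set j := ∫ r in (0:ℝ)..π, N r * sin r with hj
  set j2 := ∫ r in (0:ℝ)..π, N r ^ 2 * sin r with hj2
  set S2 := ∫ r in (0:ℝ)..π, v r * sin r ^ 2 with hS2
  have ci : ∀ g : ℝ → ℝ, Continuous g → ∀ a b, IntervalIntegrable g volume a b :=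
    fun g hg a b => hg.intervalIntegrable a b
  have hpi := Real.pi_pos
  -- C = -W + j
  have e1 : C = -W + j := by
    have := integral_eq_sub_of_hasDerivAt (a := 0) (b := π)
      (f := fun r => N r * cos r) (f' := fun r => v r * cos r - N r * sin r)
      (fun r _ => by
        have := (hNd r).mul (Real.hasDerivAt_cos r)
        exact this.congr_deriv (by ring)) (ci _ (by fun_prop) _ _)
    rw [intervalIntegral.integral_sub (ci _ (by fun_prop) _ _) (ci _ (by fun_prop) _ _)] at this
    simp only [cos_pi, hN0] at this
    linarith
  -- Cauchy-Schwarz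
  have e2 : j ^ 2 ≤ 2 * j2 := by
    have h1 : (0:ℝ) ≤ ∫ r in (0:ℝ)..π, (N r - j/2)^2 * sin r :=
      intervalIntegral.integral_nonneg hpi.le (fun r hr =>
        mul_nonneg (sq_nonneg _) (sin_nonneg_of_mem_Icc hr))
    have h2 : ∫ r in (0:ℝ)..π, (N r - j/2)^2 * sin r = j2 - j * j + (j/2)^2 * 2 := by
      have : (fun r => (N r - j/2)^2 * sin r) =
        fun r => (N r ^2 * sin r - j * (N r * sin r)) + (j/2)^2 * sin r := by ext r; ring
      rw [this, intervalIntegral.integral_add (ci _ (by fun_prop) _ _) (ci _ (by fun_prop) _ _),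
        intervalIntegral.integral_sub (ci _ (by fun_prop) _ _) (ci _ (by fun_prop) _ _),
        intervalIntegral.integral_const_mul, intervalIntegral.integral_const_mul, integral_sin]
      simp only [cos_zero, cos_pi, ← hj, ← hj2]; norm_num
    nlinarith
  -- ∫ v cos (N - W/2)
  have e3 : ∫ r in (0:ℝ)..π, v r * cos r * (N r - W/2) = (1/2) * j2 - (W/2) * j := by
    have := integral_eq_sub_of_hasDerivAt (a := 0) (b := π)
      (f := fun r => (1/2) * (N r * (N r - W)) * cos r)
      (f' := fun r => v r * cos r * (N r - W/2) - ((1/2) * (N r ^ 2 * sin r) - (W/2) * (N r * sin r)))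
      (fun r _ => by
        have := (((hNd r).mul ((hNd r).sub_const W)).const_mul (1/2)).mul (Real.hasDerivAt_cos r)
        exact this.congr_deriv (by simp only [Pi.mul_apply, Pi.sub_apply, Pi.add_apply]; ring)) (ci _ (by fun_prop) _ _)
    rw [intervalIntegral.integral_sub (ci _ (by fun_prop) _ _) (ci _ (by fun_prop) _ _),
       intervalIntegral.integral_sub (ci _ (by fun_prop) _ _) (ci _ (by fun_prop) _ _),
       intervalIntegral.integral_const_mul, intervalIntegral.integral_const_mul] at this
    simp only [hN0] at this
    rw [← hW] at this
    linarith
  set O : ℝ → ℝ := fun r => N r - W/2 + (W * cos r - C)/4 with hO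
  have hOc : Continuous O := by fun_prop
  have hOd : ∀ r, HasDerivAt O (v r - W * sin r / 4) r := fun r => by
    have := ((hNd r).sub_const (W/2)).add ((((Real.hasDerivAt_cos r).const_mul W).sub_const C).div_const 4)
    exact this.congr_deriv (by ring)
  have e4 : ∫ r in (0:ℝ)..π, v r ^ 2 * sin r =
      (∫ r in (0:ℝ)..π, -(v' r * sin r * O r)) - (∫ r in (0:ℝ)..π, v r * cos r * O r) + W/4 * S2 := by
    have := integral_eq_sub_of_hasDerivAt (a := 0) (b := π)
      (f := fun r => v r * sin r * O r)
      (f' := fun r => v r ^ 2 * sin r - (-(v' r * sin r * O r) - v r * cos r * O r + W/4 * (v r * sin r ^ 2)))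
      (fun r _ => by
        have := ((hv r).mul (Real.hasDerivAt_sin r)).mul (hOd r)
        exact this.congr_deriv (by simp only [Pi.mul_apply, Pi.sub_apply, Pi.add_apply]; ring)) (ci _ (by fun_prop) _ _)
    rw [intervalIntegral.integral_sub (ci _ (by fun_prop) _ _) (ci _ (by fun_prop) _ _),
       intervalIntegral.integral_add (ci _ (by fun_prop) _ _) (ci _ (by fun_prop) _ _),
       intervalIntegral.integral_sub (ci _ (by fun_prop) _ _) (ci _ (by fun_prop) _ _),
       intervalIntegral.integral_const_mul] at this
    simp only [sin_pi, sin_zero] at this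
    linarith
  have e5 : ∫ r in (0:ℝ)..π, v r * cos r * O r = (1/2) * j2 - (W/2) * j + W/4 * (W - S2) - C^2/4 := by
    have : (fun r => v r * cos r * O r) =
        fun r => v r * cos r * (N r - W/2) + W/4 * (v r - v r * sin r ^ 2) - C/4 * (v r * cos r) := by
      ext r
      have := sin_sq_add_cos_sq r
      have h2 : v r - v r * sin r ^ 2 = v r * cos r ^ 2 := by
        have : cos r ^ 2 = 1 - sin r ^ 2 := by linarith
        rw [this]; ring
      rw [h2]; simp only [hO]; ring
    rw [this, intervalIntegral.integral_sub (ci _ (by fun_prop) _ _) (ci _ (by fun_prop) _ _),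
       intervalIntegral.integral_add (ci _ (by fun_prop) _ _) (ci _ (by fun_prop) _ _),
       intervalIntegral.integral_const_mul, intervalIntegral.integral_const_mul,
       intervalIntegral.integral_sub (ci _ (by fun_prop) _ _) (ci _ (by fun_prop) _ _), e3]
    simp only [← hC, ← hS2]
    change _ + W/4 * (W - S2) - _ = _
    ring
  have e6 : S2 ≤ ∫ r in (0:ℝ)..π, v r * sin r := by
    apply intervalIntegral.integral_mono_on hpi.le (ci _ (by fun_prop) _ _) (ci _ (by fun_prop) _ _)
    intro r hr
    apply mul_le_mul_of_nonneg_left _ (h0 r)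
    have := sin_nonneg_of_mem_Icc hr
    nlinarith [sin_le_one r]
  have hW0 : 0 ≤ W := by rw [← hN0]; exact hNmono hpi.le
  have hOb : ∀ r ∈ Set.Icc 0 π, |O r| ≤ W/2 := by
    intro r hr
    have hsplit : ∀ g : ℝ → ℝ, Continuous g →
      (∫ s in (0:ℝ)..r, g s) + (∫ s in r..π, g s) = ∫ s in (0:ℝ)..π, g s := fun g hg =>
      intervalIntegral.integral_add_adjacent_intervals (ci _ hg _ _) (ci _ hg _ _)
    have hw : W * cos r - C = (∫ s in (0:ℝ)..r, v s * (cos r - cos s)) +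
        ∫ s in r..π, v s * (cos r - cos s) := by
      rw [hsplit _ (by fun_prop)]
      have : (fun s => v s * (cos r - cos s)) = fun s => cos r * v s - v s * cos s := by ext; ring
      rw [this, intervalIntegral.integral_sub (ci _ (by fun_prop) _ _) (ci _ (by fun_prop) _ _),
        intervalIntegral.integral_const_mul, mul_comm]
    have hWN : (∫ s in r..π, v s) = W - N r := by
      have := hsplit v hvc
      simp only [hW, hN]; linarith
    have a1 : (∫ s in (0:ℝ)..r, v s * (cos r - cos s)) ≤ 0 := by
      rw [← neg_nonneg, ← intervalIntegral.integral_neg]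
      apply intervalIntegral.integral_nonneg hr.1
      intro s hs
      have := cos_le_cos_of_nonneg_of_le_pi hs.1 hr.2 hs.2
      nlinarith [h0 s]
    have a2 : 0 ≤ (∫ s in r..π, v s * (cos r - cos s)) := by
      apply intervalIntegral.integral_nonneg hr.2
      intro s hs
      have := cos_le_cos_of_nonneg_of_le_pi hr.1 hs.2 hs.1
      nlinarith [h0 s]
    have a3 : (∫ s in r..π, v s * (cos r - cos s)) ≤ 2 * (W - N r) := by
      rw [← hWN, ← intervalIntegral.integral_const_mul]
      apply intervalIntegral.integral_mono_on hr.2 (ci _ (by fun_prop) _ _) (ci _ (by fun_prop) _ _)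
      intro s hs
      nlinarith [h0 s, cos_le_one r, neg_one_le_cos s]
    have a4 : -(2 * N r) ≤ (∫ s in (0:ℝ)..r, v s * (cos r - cos s)) := by
      have : (∫ s in (0:ℝ)..r, (-2) * v s) ≤ (∫ s in (0:ℝ)..r, v s * (cos r - cos s)) := by
        apply intervalIntegral.integral_mono_on hr.1 (ci _ (by fun_prop) _ _) (ci _ (by fun_prop) _ _)
        intro s hs
        nlinarith [h0 s, cos_le_one s, neg_one_le_cos r]
      rw [intervalIntegral.integral_const_mul] at this
      simp only [hN]; linarith
    have a5 : N r ≤ W := hNmono hr.2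
    have a6 : 0 ≤ N r := by rw [← hN0]; exact hNmono hr.1
    rw [abs_le]
    constructor <;> simp only [hO] <;> linarith
  have e7 : (∫ r in (0:ℝ)..π, -(v' r * sin r * O r)) ≤ (W/2) * ∫ r in (0:ℝ)..π, |v' r| * sin r := by
    rw [← intervalIntegral.integral_const_mul]
    apply intervalIntegral.integral_mono_on hpi.le (ci _ (by fun_prop) _ _) (ci _ (by fun_prop) _ _)
    intro r hr
    have hs := sin_nonneg_of_mem_Icc hr
    calc -(v' r * sin r * O r) ≤ |v' r * sin r * O r| := neg_le_abs _
      _ = (|v' r| * sin r) * |O r| := by rw [abs_mul, abs_mul, abs_of_nonneg hs]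
      _ ≤ (|v' r| * sin r) * (W/2) := by gcongr; exact hOb r hr
      _ = _ := by ring
  change _ ≤ 1/2 * W * _
  rw [e4, e5]
  have hC2 : C^2 = (-W+j)^2 := by rw [e1]
  have e8 := mul_le_mul_of_nonneg_left e6 hW0
  rw [hC2]
  nlinarith [e2, e7, e8]

lemma W_ineq (v v' : ℝ → ℝ) (hv : ∀ r, HasDerivAt v (v' r) r) (hv' : Continuous v') :
    ∫ r in (0:ℝ)..π, v r ≤
      π/2 * (∫ r in (0:ℝ)..π, v r * sin r) + ∫ r in (0:ℝ)..π, |v' r| * sin r := by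
  have hvc : Continuous v := continuous_iff_continuousAt.2 fun r => (hv r).continuousAt
  have ci : ∀ g : ℝ → ℝ, Continuous g → ∀ a b, IntervalIntegrable g volume a b :=
    fun g hg a b => hg.intervalIntegrable a b
  have hpi := Real.pi_pos
  set φ : ℝ → ℝ := fun r => r - π/2 * (1 - cos r) with hφ
  have hφc : Continuous φ := by fun_prop
  have hφd : ∀ r, HasDerivAt φ (1 - π/2 * sin r) r := fun r => by
    have := (hasDerivAt_id r).sub (((Real.hasDerivAt_cos r).const_sub 1).const_mul (π/2))
    exact this.congr_deriv (by ring)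
  have half : ∀ r ∈ Set.Icc 0 (π/2), |φ r| ≤ sin r := by
    intro r hr
    have g1 : r - π/2 * (1 - cos r) ≥ 0 := by
      have := Real.one_sub_mul_le_cos (x := r) hr.1 hr.2
      have h2 : π/2 * (1 - 2/π*r) ≤ π/2 * cos r := by gcongr
      have h3 : π/2 * (1 - 2/π*r) = π/2 - r := by field_simp
      nlinarith
    have g2 : r - π/2 * (1 - cos r) ≤ sin r := by
      have mono : MonotoneOn (fun r => sin r - r + π/2 * (1 - cos r)) (Set.Icc 0 (π/2)) := by
        apply monotoneOn_of_hasDerivWithinAt_nonneg (f' := fun r => cos r - 1 + π/2 * sin r) (convex_Icc _ _) (by fun_prop)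
        · intro x hx
          have := ((Real.hasDerivAt_sin x).sub (hasDerivAt_id x)).add (((Real.hasDerivAt_cos x).const_sub 1).const_mul (π/2))
          refine (HasDerivAt.hasDerivWithinAt ?_)
          exact this.congr_deriv (by ring)
        · intro x hx
          rw [interior_Icc] at hx
          have hs : 0 ≤ sin x := sin_nonneg_of_nonneg_of_le_pi hx.1.le (by linarith [hx.2])
          have hc : 0 ≤ cos x := cos_nonneg_of_mem_Icc ⟨by linarith [hx.1], hx.2.le⟩
          have := sin_sq_add_cos_sq x
          nlinarith [sin_le_one x, cos_le_one x, Real.pi_gt_three]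
      have := mono (Set.left_mem_Icc.2 (by positivity)) hr hr.1
      simp at this
      linarith
    rw [abs_of_nonneg g1]; exact g2
  have hb : ∀ r ∈ Set.Icc 0 π, |φ r| ≤ sin r := by
    intro r hr
    by_cases h : r ≤ π/2
    · exact half r ⟨hr.1, h⟩
    · have := half (π - r) ⟨by linarith [hr.2], by linarith⟩
      rw [sin_pi_sub] at this
      have e : φ r = - φ (π - r) := by simp only [hφ, cos_pi_sub]; ring
      rwa [e, abs_neg]
  have e := integral_eq_sub_of_hasDerivAt (a := 0) (b := π)
      (f := fun r => v r * φ r) (f' := fun r => (v r - π/2 * (v r * sin r)) + v' r * φ r)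
      (fun r _ => by
        have := (hv r).mul (hφd r)
        exact this.congr_deriv (by ring)) (ci _ (by fun_prop) _ _)
  rw [intervalIntegral.integral_add (ci _ (by fun_prop) _ _) (ci _ (by fun_prop) _ _),
       intervalIntegral.integral_sub (ci _ (by fun_prop) _ _) (ci _ (by fun_prop) _ _),
       intervalIntegral.integral_const_mul] at e
  have z1 : φ π = 0 := by simp [hφ]; ring
  have z2 : φ 0 = 0 := by simp [hφ]
  rw [z1, z2] at e
  have f : (∫ r in (0:ℝ)..π, -(v' r * φ r)) ≤ ∫ r in (0:ℝ)..π, |v' r| * sin r := by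
    apply intervalIntegral.integral_mono_on hpi.le (ci _ (by fun_prop) _ _) (ci _ (by fun_prop) _ _)
    intro r hr
    calc -(v' r * φ r) ≤ |v' r * φ r| := neg_le_abs _
      _ = |v' r| * |φ r| := abs_mul _ _
      _ ≤ _ := by gcongr; exact hb r hr
  rw [intervalIntegral.integral_neg] at f
  linarith

lemma circ_ineq (w w' : ℝ → ℝ) (hw : ∀ r, HasDerivAt w (w' r) r) (hw' : Continuous w')
    (hp : w (2*π) = w 0) (a : ℝ) (ha : a ∈ Set.Icc 0 (2*π)) :
    w a ≤ (∫ b in (0:ℝ)..(2*π), w b) / (2*π) + (1/2) * ∫ b in (0:ℝ)..(2*π), |w' b| := by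
  have hwc : Continuous w := continuous_iff_continuousAt.2 fun r => (hw r).continuousAt
  have ci : ∀ g : ℝ → ℝ, Continuous g → ∀ a b, IntervalIntegrable g volume a b :=
    fun g hg a b => hg.intervalIntegrable a b
  have hpi := Real.pi_pos
  have ft : ∀ x y, x ≤ y → |w y - w x| ≤ ∫ b in x..y, |w' b| := by
    intro x y hxy
    rw [← integral_eq_sub_of_hasDerivAt (fun r _ => hw r) (ci _ hw' _ _)]
    exact intervalIntegral.abs_integral_le_integral_abs hxy
  have hsum : ∀ x y, x ∈ Set.Icc 0 (2*π) → y ∈ Set.Icc 0 (2*π) → x ≤ y →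
      2 * |w y - w x| ≤ ∫ b in (0:ℝ)..(2*π), |w' b| := by
    intro x y hx hy hxy
    have h1 := ft 0 x hx.1
    have h2 := ft x y hxy
    have h3 := ft y (2*π) hy.2
    have s1 := intervalIntegral.integral_add_adjacent_intervals (ci _ hw'.abs 0 x) (ci _ hw'.abs x y)
    have s2 := intervalIntegral.integral_add_adjacent_intervals (ci _ hw'.abs 0 y) (ci _ hw'.abs y (2*π))
    have : |w y - w x| ≤ |w (2*π) - w y| + |w x - w 0| := by
      rw [hp, abs_sub_comm (w y) (w x)]
      calc |w x - w y| = |(w 0 - w y) + (w x - w 0)| := by congr 1; ring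
        _ ≤ _ := abs_add_le _ _
    linarith
  have hpt : ∀ b ∈ Set.Icc 0 (2*π), w a - (1/2) * (∫ b in (0:ℝ)..(2*π), |w' b|) ≤ w b := by
    intro b hb
    rcases le_total a b with h | h
    · have := hsum a b ha hb h
      have := neg_abs_le (w b - w a)
      linarith
    · have := hsum b a hb ha h
      have := le_abs_self (w a - w b)
      linarith
  have := intervalIntegral.integral_mono_on (by positivity) (ci (fun _ => w a - (1/2) * (∫ b in (0:ℝ)..(2*π), |w' b|)) continuous_const 0 (2*π)) (ci _ hwc _ _) hpt
  rw [intervalIntegral.integral_const, smul_eq_mul, sub_zero] at this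
  have h2 : w a - (1/2) * (∫ b in (0:ℝ)..(2*π), |w' b|) ≤ (∫ b in (0:ℝ)..(2*π), w b) / (2*π) := by
    rw [le_div_iff₀ (by positivity)]; linarith
  linarith

lemma swap_int (g : ℝ → ℝ → ℝ) (hg : Continuous (Function.uncurry g)) (a b c d : ℝ) :
    ∫ r in a..b, ∫ t in c..d, g r t = ∫ t in c..d, ∫ r in a..b, g r t := by
  apply MeasureTheory.intervalIntegral_intervalIntegral_swap
  have : IntegrableOn (Function.uncurry g) (Set.uIcc a b ×ˢ Set.uIcc c d) (volume.prod volume) :=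
    hg.continuousOn.integrableOn_compact (isCompact_uIcc.prod isCompact_uIcc)
  exact this.mono_set (Set.prod_mono Set.uIoc_subset_uIcc Set.uIoc_subset_uIcc)

lemma cont_param (g : ℝ → ℝ → ℝ) (hg : Continuous (Function.uncurry g)) (a b : ℝ) :
    Continuous fun r => ∫ t in a..b, g r t :=
  intervalIntegral.continuous_parametric_intervalIntegral_of_continuous' hg a b

lemma cont_param' (g : ℝ → ℝ → ℝ) (hg : Continuous (Function.uncurry g)) (a b : ℝ) :
    Continuous fun t => ∫ r in a..b, g r t :=
  intervalIntegral.continuous_parametric_intervalIntegral_of_continuous' (f := fun t r => g r t)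
    (hg.comp continuous_swap) a b

lemma alg_ineq (x y s : ℝ) (hx : 0 ≤ x) (hy : 0 ≤ y) (hs : 0 ≤ s) :
    π * ((1/2) * (y/2 + x/(2*π) + s/4) * (x + s)) ≤ x^2 + y^2 + s^2 := by
  have hpi := Real.pi_pos
  have e : π * ((1/2) * (y/2 + x/(2*π) + s/4) * (x + s)) =
      (1/4) * ((π * (y + s/2) + x) * (x+s)) := by
    field_simp; ring
  rw [e]
  have h1 : π * (y + s/2) ≤ 3.1416 * (y + s/2) := by
    have := Real.pi_lt_d4
    gcongr
  have h2 : (π * (y + s/2) + x) * (x+s) ≤ (3.1416 * (y + s/2) + x) * (x+s) := by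
    gcongr
  nlinarith [sq_nonneg (2*y - 3.1416*(x+s)/4), sq_nonneg (x - 0.85 * s), sq_nonneg x, sq_nonneg s]

lemma sobolev (u ur ut : ℝ → ℝ → ℝ) (hu : Continuous (Function.uncurry u))
    (hur : Continuous (Function.uncurry ur)) (hut : Continuous (Function.uncurry ut))
    (dr : ∀ r t, HasDerivAt (fun s => u s t) (ur r t) r)
    (dt : ∀ r t, HasDerivAt (u r) (ut r t) t)
    (h0 : ∀ r t, 0 ≤ u r t) (hp : ∀ r, u r (2*π) = u r 0) :
    π * sphereIntegral (fun r t => u r t ^ 2) ≤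
      (sphereIntegral fun r t => |ur r t|) ^ 2 +
      (∫ r in (0:ℝ)..π, ∫ t in (0:ℝ)..(2*π), |ut r t|) ^ 2 + (sphereIntegral u) ^ 2 := by
  have hpi := Real.pi_pos
  have ci : ∀ g : ℝ → ℝ, Continuous g → ∀ a b, IntervalIntegrable g volume a b :=
    fun g hg a b => hg.intervalIntegrable a b
  have cr : ∀ t, Continuous fun r => u r t := fun t => hu.comp (by fun_prop : Continuous fun r : ℝ => (r, t))
  have crr : ∀ t, Continuous fun r => ur r t := fun t => hur.comp (by fun_prop : Continuous fun r : ℝ => (r, t))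
  have ct : ∀ r, Continuous fun t => u r t := fun r => hu.comp (by fun_prop : Continuous fun t : ℝ => (r, t))
  have ctt : ∀ r, Continuous fun t => ut r t := fun r => hut.comp (by fun_prop : Continuous fun t : ℝ => (r, t))
  have c1 : Continuous (Function.uncurry fun r t => u r t * sin r) :=
    hu.mul (Real.continuous_sin.comp continuous_fst)
  have c2 : Continuous (Function.uncurry fun r t => |ur r t| * sin r) :=
    hur.abs.mul (Real.continuous_sin.comp continuous_fst)
  have c3 : Continuous (Function.uncurry fun r t => u r t ^ 2 * sin r) :=
    (hu.pow 2).mul (Real.continuous_sin.comp continuous_fst)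
  have c4 : Continuous (Function.uncurry fun r t => |ut r t|) := hut.abs
  set x := sphereIntegral (fun r t => |ur r t|) with hx
  set y := ∫ r in (0:ℝ)..π, ∫ t in (0:ℝ)..(2*π), |ut r t| with hy
  set U := sphereIntegral u with hU
  set W := ∫ r in (0:ℝ)..π, ∫ t in (0:ℝ)..(2*π), u r t with hW
  have hx' : x = ∫ t in (0:ℝ)..(2*π), ∫ r in (0:ℝ)..π, |ur r t| * sin r := swap_int _ c2 _ _ _ _
  have hU' : U = ∫ t in (0:ℝ)..(2*π), ∫ r in (0:ℝ)..π, u r t * sin r := swap_int _ c1 _ _ _ _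
  have hW' : W = ∫ t in (0:ℝ)..(2*π), ∫ r in (0:ℝ)..π, u r t := swap_int _ hu _ _ _ _
  have p2 : (0:ℝ) ≤ 2 * π := by positivity
  have x0 : 0 ≤ x := intervalIntegral.integral_nonneg hpi.le fun r hr =>
    intervalIntegral.integral_nonneg p2 fun t ht =>
      mul_nonneg (abs_nonneg _) (sin_nonneg_of_mem_Icc hr)
  have y0 : 0 ≤ y := intervalIntegral.integral_nonneg hpi.le fun r hr =>
    intervalIntegral.integral_nonneg p2 fun t ht => abs_nonneg _
  have U0 : 0 ≤ U := intervalIntegral.integral_nonneg hpi.le fun r hr =>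
    intervalIntegral.integral_nonneg p2 fun t ht =>
      mul_nonneg (h0 _ _) (sin_nonneg_of_mem_Icc hr)
  have s1 : W ≤ π/2 * U + x := by
    rw [hW', hU', hx', ← intervalIntegral.integral_const_mul, ← intervalIntegral.integral_add]
    · apply intervalIntegral.integral_mono_on p2
      · exact ci _ (cont_param' _ hu _ _) _ _
      · exact ci _ ((continuous_const.mul (cont_param' _ c1 _ _)).add (cont_param' _ c2 _ _)) _ _
      · intro t ht
        exact W_ineq _ _ (fun r => dr r t) (crr t)
    · exact ci _ (continuous_const.mul (cont_param' _ c1 _ _)) _ _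
    · exact ci _ (cont_param' _ c2 _ _) _ _
  have s2 : ∀ t ∈ Set.Icc 0 (2*π), (∫ r in (0:ℝ)..π, u r t) ≤ y/2 + x/(2*π) + U/4 := by
    intro t ht
    have : (∫ r in (0:ℝ)..π, u r t) ≤ ∫ r in (0:ℝ)..π, ((∫ t in (0:ℝ)..(2*π), u r t) / (2*π) +
        (1/2) * ∫ t in (0:ℝ)..(2*π), |ut r t|) := by
      apply intervalIntegral.integral_mono_on hpi.le (ci _ (cr t) _ _)
      · exact ci _ (((cont_param _ hu _ _).div_const _).add (continuous_const.mul (cont_param _ c4 _ _))) _ _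
      · intro r hr
        exact circ_ineq _ _ (dt r) (ctt r) (hp r) t ht
    have i1 : IntervalIntegrable (fun r => (∫ t in (0:ℝ)..(2*π), u r t) / (2*π)) volume 0 π :=
      ci _ ((cont_param _ hu _ _).div_const _) _ _
    have i2 : IntervalIntegrable (fun r => (1/2) * ∫ t in (0:ℝ)..(2*π), |ut r t|) volume 0 π :=
      ci _ (continuous_const.mul (cont_param _ c4 _ _)) _ _
    rw [intervalIntegral.integral_add i1 i2, intervalIntegral.integral_div,
      intervalIntegral.integral_const_mul, ← hW, ← hy] at this
    have h3 : W / (2*π) ≤ (π/2 * U + x) / (2*π) := by gcongr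
    have h4 : (π/2 * U + x) / (2*π) = U/4 + x/(2*π) := by field_simp; ring
    linarith
  have s3 : sphereIntegral (fun r t => u r t ^ 2) ≤ (1/2) * (y/2 + x/(2*π) + U/4) * (x + U) := by
    have : sphereIntegral (fun r t => u r t ^ 2) =
      ∫ t in (0:ℝ)..(2*π), ∫ r in (0:ℝ)..π, u r t ^ 2 * sin r := swap_int _ c3 _ _ _ _
    rw [this]
    set K := y/2 + x/(2*π) + U/4
    rw [hx', hU', ← intervalIntegral.integral_add (ci _ (cont_param' _ c2 _ _) _ _) (ci _ (cont_param' _ c1 _ _) _ _),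
      ← intervalIntegral.integral_const_mul]
    apply intervalIntegral.integral_mono_on p2 (ci _ (cont_param' _ c3 _ _) _ _)
    · exact ci _ (continuous_const.mul ((cont_param' _ c2 _ _).add (cont_param' _ c1 _ _))) _ _
    · intro t ht
      refine (merid_ineq _ _ (fun r => dr r t) (crr t) (fun r => h0 r t)).trans ?_
      have n1 : 0 ≤ ∫ r in (0:ℝ)..π, |ur r t| * sin r :=
        intervalIntegral.integral_nonneg hpi.le fun r hr =>
          mul_nonneg (abs_nonneg _) (sin_nonneg_of_mem_Icc hr)
      have n2 : 0 ≤ ∫ r in (0:ℝ)..π, u r t * sin r :=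
        intervalIntegral.integral_nonneg hpi.le fun r hr =>
          mul_nonneg (h0 _ _) (sin_nonneg_of_mem_Icc hr)
      have := s2 t ht
      gcongr
  calc π * sphereIntegral (fun r t => u r t ^ 2) ≤ π * ((1/2) * (y/2 + x/(2*π) + U/4) * (x + U)) := by gcongr
    _ ≤ _ := alg_ineq x y U x0 y0 U0

lemma quad_opt (x y J B : ℝ) (hB : 0 ≤ B)
    (h : ∀ a b : ℝ, 2 * a * x + 2 * b * y ≤ J + (a^2 + b^2) * B) : x^2 + y^2 ≤ J * B := by
  set Q := x^2 + y^2 with hQ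
  have hJ : 0 ≤ J := by have := h 0 0; simpa using this
  have h1 : ∀ l : ℝ, 0 ≤ (Q * B) * (l * l) + (-2 * Q) * l + J := fun l => by
    have := h (l * x) (l * y)
    simp only [hQ]; nlinarith
  have h2 := discrim_le_zero h1
  rw [discrim] at h2
  have hQ0 : 0 ≤ Q := by positivity
  rcases hQ0.eq_or_lt with h3 | h3
  · rw [← h3]; positivity
  · have : Q * Q ≤ Q * (J * B) := by nlinarith
    exact le_of_mul_le_mul_left this h3

lemma energy (F Fr Ft Frr Ftt : ℝ → ℝ → ℝ)
    (cF : Continuous (Function.uncurry F)) (cFr : Continuous (Function.uncurry Fr))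
    (cFt : Continuous (Function.uncurry Ft)) (cFrr : Continuous (Function.uncurry Frr))
    (cFtt : Continuous (Function.uncurry Ftt))
    (dr : ∀ r t, HasDerivAt (fun s => F s t) (Fr r t) r)
    (dt : ∀ r t, HasDerivAt (F r) (Ft r t) t)
    (drr : ∀ r t, HasDerivAt (fun s => Fr s t) (Frr r t) r)
    (dtt : ∀ r t, HasDerivAt (Ft r) (Ftt r t) t)
    (pF : ∀ r, F r (2*π) = F r 0) (pFt : ∀ r, Ft r (2*π) = Ft r 0)
    (lap : ∀ r ∈ Set.Ioo 0 π, ∀ t, Frr r t + cos r / sin r * Fr r t + 1 / sin r ^ 2 * Ftt r t ≤ F r t)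
    (Ψ ψ : ℝ → ℝ) (dΨ : ∀ z, HasDerivAt Ψ (ψ z) z) (cψ : Continuous ψ)
    (Ψ1 : ∀ z, Ψ z ≤ 1) (ψ0 : ∀ z, 0 ≤ ψ z) (a b : ℝ) :
    2 * a * (sphereIntegral fun r t => |ψ (F r t) * Fr r t|) +
      2 * b * (∫ r in (0:ℝ)..π, ∫ t in (0:ℝ)..(2*π), |ψ (F r t) * Ft r t|) ≤
    (sphereIntegral fun r t => (1 - Ψ (F r t)) * F r t) +
      (a^2 + b^2) * sphereIntegral fun r t => ψ (F r t) := by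
  have hpi := Real.pi_pos
  have p2 : (0:ℝ) ≤ 2 * π := by positivity
  have ci : ∀ g : ℝ → ℝ, Continuous g → ∀ a b, IntervalIntegrable g volume a b :=
    fun g hg a b => hg.intervalIntegrable a b
  have cΨ : Continuous Ψ := continuous_iff_continuousAt.2 fun r => (dΨ r).continuousAt
  have sl : ∀ G : ℝ → ℝ → ℝ, Continuous (Function.uncurry G) → ∀ r, Continuous (G r) :=
    fun G hG r => hG.comp (by fun_prop : Continuous fun t : ℝ => (r, t))
  have slr : ∀ G : ℝ → ℝ → ℝ, Continuous (Function.uncurry G) → ∀ t, Continuous fun r => G r t :=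
    fun G hG t => hG.comp (by fun_prop : Continuous fun r : ℝ => (r, t))
  have cs : Continuous fun q : ℝ × ℝ => sin q.1 := Real.continuous_sin.comp continuous_fst
  have cc : Continuous fun q : ℝ × ℝ => cos q.1 := Real.continuous_cos.comp continuous_fst
  have cF' : Continuous fun q : ℝ × ℝ => F q.1 q.2 := cF
  have cFr' : Continuous fun q : ℝ × ℝ => Fr q.1 q.2 := cFr
  have cFt' : Continuous fun q : ℝ × ℝ => Ft q.1 q.2 := cFt
  have cFrr' : Continuous fun q : ℝ × ℝ => Frr q.1 q.2 := cFrr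
  have cFtt' : Continuous fun q : ℝ × ℝ => Ftt q.1 q.2 := cFtt
  have cψF : Continuous fun q : ℝ × ℝ => ψ (F q.1 q.2) := cψ.comp cF
  have cΨF : Continuous fun q : ℝ × ℝ => Ψ (F q.1 q.2) := cΨ.comp cF
  have Ψr : ∀ r t, HasDerivAt (fun s => Ψ (F s t)) (ψ (F r t) * Fr r t) r := fun r t =>
    (dΨ (F r t)).comp r (dr r t)
  have Ψt : ∀ r t, HasDerivAt (fun s => Ψ (F r s)) (ψ (F r t) * Ft r t) t := fun r t =>
    (dΨ (F r t)).comp t (dt r t)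
  -- the r-divergence
  set D : ℝ → ℝ → ℝ := fun r t => -(ψ (F r t) * Fr r t ^ 2 * sin r) +
    (1 - Ψ (F r t)) * (Frr r t * sin r + Fr r t * cos r) with hD
  have cD : Continuous (Function.uncurry D) := by
    change Continuous fun q : ℝ × ℝ => _
    simp only [Function.uncurry_def, hD]
    fun_prop
  have D0 : ∫ r in (0:ℝ)..π, ∫ t in (0:ℝ)..(2*π), D r t = 0 := by
    rw [swap_int D cD]
    have : ∀ t, ∫ r in (0:ℝ)..π, D r t = 0 := by
      intro t
      rw [integral_eq_sub_of_hasDerivAt (f := fun r => (1 - Ψ (F r t)) * (Fr r t * sin r))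
        (fun r _ => ?_) (ci _ (slr D cD t) _ _)]
      · simp
      · refine (((Ψr r t).const_sub 1).mul ((drr r t).mul (Real.hasDerivAt_sin r))).congr_deriv ?_
        simp only [Pi.mul_apply, hD]; ring
    simp [this]
  set K : ℝ → ℝ → ℝ := fun r t => ((1 - Ψ (F r t)) * F r t * sin r + (a^2+b^2) * (ψ (F r t) * sin r)) -
    (2 * a * (|ψ (F r t) * Fr r t| * sin r) + 2 * b * |ψ (F r t) * Ft r t|) with hK
  have cJ : Continuous (Function.uncurry fun r t => (1 - Ψ (F r t)) * F r t * sin r) := by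
    simp only [Function.uncurry_def]; fun_prop
  have cB : Continuous (Function.uncurry fun r t => ψ (F r t) * sin r) := by
    simp only [Function.uncurry_def]; fun_prop
  have cX : Continuous (Function.uncurry fun r t => |ψ (F r t) * Fr r t| * sin r) := by
    simp only [Function.uncurry_def]; fun_prop
  have cY : Continuous (Function.uncurry fun r t => |ψ (F r t) * Ft r t|) := by
    simp only [Function.uncurry_def]; fun_prop
  have cK : Continuous (Function.uncurry K) := by
    simp only [Function.uncurry_def, hK]; fun_prop
  have DK : ∀ r ∈ Set.Ioo 0 π, ∫ t in (0:ℝ)..(2*π), D r t ≤ ∫ t in (0:ℝ)..(2*π), K r t := by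
    intro r hr
    have hs : 0 < sin r := sin_pos_of_mem_Ioo hr
    set E : ℝ → ℝ := fun t => -(ψ (F r t) * Ft r t ^ 2) + (1 - Ψ (F r t)) * Ftt r t with hE
    have s1 := sl F cF r
    have s2 := sl Ft cFt r
    have s3 := sl Ftt cFtt r
    have s4 := sl Fr cFr r
    have s5 := sl Frr cFrr r
    have cE : Continuous E := by fun_prop
    have E0 : ∫ t in (0:ℝ)..(2*π), E t = 0 := by
      rw [integral_eq_sub_of_hasDerivAt (f := fun t => (1 - Ψ (F r t)) * Ft r t)
        (fun t _ => ?_) (ci _ cE _ _)]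
      · simp only [pF, pFt, sub_self]
      · refine (((Ψt r t).const_sub 1).mul (dtt r t)).congr_deriv ?_
        simp only [hE]; ring
    have : ∫ t in (0:ℝ)..(2*π), D r t ≤ ∫ t in (0:ℝ)..(2*π), (K r t - (1/sin r) * E t) := by
      apply intervalIntegral.integral_mono_on p2 (ci _ (sl D cD r) _ _)
        (ci _ ((sl K cK r).sub (continuous_const.mul cE)) _ _)
      intro t _
      have l := lap r hr t
      have l2 : (1 - Ψ (F r t)) * sin r * (Frr r t + cos r / sin r * Fr r t + 1 / sin r ^ 2 * Ftt r t)
          ≤ (1 - Ψ (F r t)) * sin r * F r t :=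
        mul_le_mul_of_nonneg_left l (mul_nonneg (by linarith [Ψ1 (F r t)]) hs.le)
      have l3 : (1 - Ψ (F r t)) * sin r * (Frr r t + cos r / sin r * Fr r t + 1 / sin r ^ 2 * Ftt r t)
        = (1 - Ψ (F r t)) * (Frr r t * sin r + Fr r t * cos r) + (1/sin r) * ((1 - Ψ (F r t)) * Ftt r t) := by
        field_simp
      have q := ψ0 (F r t)
      have m1 : 0 ≤ ψ (F r t) * sin r * (|Fr r t| - a)^2 := by positivity
      have m2 : 0 ≤ ψ (F r t) * (1/sin r) * (|Ft r t| - b * sin r)^2 := by positivity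
      have m3 : ψ (F r t) * (1/sin r) * (|Ft r t| - b * sin r)^2 =
        (1/sin r) * (ψ (F r t) * Ft r t ^ 2) - 2 * b * (ψ (F r t) * |Ft r t|) + b^2 * (ψ (F r t) * sin r) := by
        rw [← sq_abs (Ft r t)]; field_simp; ring
      have m4 : ψ (F r t) * sin r * (|Fr r t| - a)^2 =
        ψ (F r t) * Fr r t ^ 2 * sin r - 2 * a * (ψ (F r t) * |Fr r t| * sin r) + a^2 * (ψ (F r t) * sin r) := by
        rw [← sq_abs (Fr r t)]; ring
      rw [m3] at m2
      rw [m4] at m1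
      rw [l3] at l2
      change D r t ≤ K r t - 1 / sin r * E t
      simp only [hD, hK, hE, abs_mul, abs_of_nonneg q]
      clear m3 m4 l3 l lap
      generalize 1 / sin r = c at *
      linarith
    rw [intervalIntegral.integral_sub (ci _ (sl K cK r) _ _) (ci _ (by fun_prop) _ _),
      intervalIntegral.integral_const_mul, E0] at this
    simpa using this
  have fin : ∫ r in (0:ℝ)..π, ∫ t in (0:ℝ)..(2*π), D r t ≤ ∫ r in (0:ℝ)..π, ∫ t in (0:ℝ)..(2*π), K r t :=
    intervalIntegral.integral_mono_on_of_le_Ioo hpi.le (ci _ (cont_param D cD _ _) _ _)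
      (ci _ (cont_param K cK _ _) _ _) DK
  rw [D0] at fin
  have split : ∫ r in (0:ℝ)..π, ∫ t in (0:ℝ)..(2*π), K r t =
    ((sphereIntegral fun r t => (1 - Ψ (F r t)) * F r t) +
      (a^2 + b^2) * sphereIntegral fun r t => ψ (F r t)) -
    (2 * a * (sphereIntegral fun r t => |ψ (F r t) * Fr r t|) +
      2 * b * (∫ r in (0:ℝ)..π, ∫ t in (0:ℝ)..(2*π), |ψ (F r t) * Ft r t|)) := by
    have inner : ∀ r, ∫ t in (0:ℝ)..(2*π), K r t =
      ((∫ t in (0:ℝ)..(2*π), (1 - Ψ (F r t)) * F r t * sin r) +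
        (a^2+b^2) * ∫ t in (0:ℝ)..(2*π), (ψ (F r t) * sin r)) -
      (2 * a * (∫ t in (0:ℝ)..(2*π), |ψ (F r t) * Fr r t| * sin r) +
        2 * b * ∫ t in (0:ℝ)..(2*π), |ψ (F r t) * Ft r t|) := by
      intro r
      have i1 := ci _ (sl _ cJ r) 0 (2*π)
      have i2 := (ci _ (sl _ cB r) 0 (2*π)).const_mul (a^2+b^2)
      have i3 := (ci _ (sl _ cX r) 0 (2*π)).const_mul (2*a)
      have i4 := (ci _ (sl _ cY r) 0 (2*π)).const_mul (2*b)
      simp only [hK]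
      rw [intervalIntegral.integral_sub (i1.add i2) (i3.add i4),
        intervalIntegral.integral_add i1 i2, intervalIntegral.integral_add i3 i4]
      simp only [intervalIntegral.integral_const_mul]
    simp only [inner, sphereIntegral]
    have i1 := ci _ (cont_param _ cJ 0 (2*π)) 0 π
    have i2 := (ci _ (cont_param _ cB 0 (2*π)) 0 π).const_mul (a^2+b^2)
    have i3 := (ci _ (cont_param _ cX 0 (2*π)) 0 π).const_mul (2*a)
    have i4 := (ci _ (cont_param _ cY 0 (2*π)) 0 π).const_mul (2*b)
    rw [intervalIntegral.integral_sub (i1.add i2) (i3.add i4),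
        intervalIntegral.integral_add i1 i2, intervalIntegral.integral_add i3 i4]
    simp only [intervalIntegral.integral_const_mul]
  rw [split] at fin
  linarith

lemma level_ineq' (F Fr Ft Frr Ftt : ℝ → ℝ → ℝ)
    (cF : Continuous (Function.uncurry F)) (cFr : Continuous (Function.uncurry Fr))
    (cFt : Continuous (Function.uncurry Ft)) (cFrr : Continuous (Function.uncurry Frr))
    (cFtt : Continuous (Function.uncurry Ftt))
    (dr : ∀ r t, HasDerivAt (fun s => F s t) (Fr r t) r)
    (dt : ∀ r t, HasDerivAt (F r) (Ft r t) t)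
    (drr : ∀ r t, HasDerivAt (fun s => Fr s t) (Frr r t) r)
    (dtt : ∀ r t, HasDerivAt (Ft r) (Ftt r t) t)
    (pF : ∀ r, F r (2*π) = F r 0) (pFt : ∀ r, Ft r (2*π) = Ft r 0)
    (lap : ∀ r ∈ Set.Ioo 0 π, ∀ t, Frr r t + cos r / sin r * Fr r t + 1 / sin r ^ 2 * Ftt r t ≤ F r t)
    (Ψ ψ : ℝ → ℝ) (dΨ : ∀ z, HasDerivAt Ψ (ψ z) z) (cψ : Continuous ψ)
    (Ψ0 : ∀ z, 0 ≤ Ψ z) (Ψ1 : ∀ z, Ψ z ≤ 1) (ψ0 : ∀ z, 0 ≤ ψ z) :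
    π * sphereIntegral (fun r t => Ψ (F r t) ^ 2) ≤
      (sphereIntegral fun r t => (1 - Ψ (F r t)) * F r t) * (sphereIntegral fun r t => ψ (F r t)) +
      (sphereIntegral fun r t => Ψ (F r t)) ^ 2 := by
  have hpi := Real.pi_pos
  have p2 : (0:ℝ) ≤ 2 * π := by positivity
  have cΨ : Continuous Ψ := continuous_iff_continuousAt.2 fun r => (dΨ r).continuousAt
  have cψF : Continuous fun q : ℝ × ℝ => ψ (F q.1 q.2) := cψ.comp cF
  have B0 : 0 ≤ sphereIntegral fun r t => ψ (F r t) :=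
    intervalIntegral.integral_nonneg hpi.le fun r hr =>
      intervalIntegral.integral_nonneg p2 fun t ht =>
      mul_nonneg (ψ0 _) (sin_nonneg_of_mem_Icc hr)
  have h1 := quad_opt _ _ _ _ B0 (energy F Fr Ft Frr Ftt cF cFr cFt cFrr cFtt dr dt drr dtt pF pFt lap
    Ψ ψ dΨ cψ Ψ1 ψ0)
  have h2 := sobolev (fun r t => Ψ (F r t)) (fun r t => ψ (F r t) * Fr r t)
    (fun r t => ψ (F r t) * Ft r t) (cΨ.comp cF) (cψF.mul cFr) (cψF.mul cFt)
    (fun r t => (dΨ (F r t)).comp r (dr r t)) (fun r t => (dΨ (F r t)).comp t (dt r t))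
    (fun r t => Ψ0 _) (fun r => by simp only [pF])
  linarith

lemma partial1 (F : ℝ → ℝ → ℝ) (h : ContDiff ℝ (⊤ : ℕ∞) (Function.uncurry F)) :
    ContDiff ℝ (⊤ : ℕ∞) (Function.uncurry fun r t => deriv (fun s => F s t) r) ∧
    ∀ r t, HasDerivAt (fun s => F s t) (deriv (fun s => F s t) r) r := by
  have hd : ∀ r t, HasDerivAt (fun s => F s t) (fderiv ℝ (Function.uncurry F) (r, t) (1, 0)) r := by
    intro r t
    have h1 : HasFDerivAt (Function.uncurry F) (fderiv ℝ (Function.uncurry F) (r, t)) (r, t) :=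
      ((h.differentiable (by simp)) (r, t)).hasFDerivAt
    have h2 : HasDerivAt (fun s : ℝ => (s, t)) ((1:ℝ), (0:ℝ)) r :=
      (hasDerivAt_id r).prodMk (hasDerivAt_const r t)
    exact h1.comp_hasDerivAt r h2
  refine ⟨?_, fun r t => by rw [(hd r t).deriv]; exact hd r t⟩
  have : (Function.uncurry fun r t => deriv (fun s => F s t) r) =
      fun q : ℝ × ℝ => fderiv ℝ (Function.uncurry F) q (1, 0) := by
    ext ⟨r, t⟩
    simp only [Function.uncurry, (hd r t).deriv]
  rw [this]
  exact (h.fderiv_right (m := (⊤ : ℕ∞)) (by simp)).clm_apply contDiff_const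

lemma partial2 (F : ℝ → ℝ → ℝ) (h : ContDiff ℝ (⊤ : ℕ∞) (Function.uncurry F)) :
    ContDiff ℝ (⊤ : ℕ∞) (Function.uncurry fun r t => deriv (F r) t) ∧
    ∀ r t, HasDerivAt (F r) (deriv (F r) t) t := by
  have h' : ContDiff ℝ (⊤ : ℕ∞) (Function.uncurry fun t r => F r t) :=
    h.comp (contDiff_snd.prodMk contDiff_fst)
  obtain ⟨a, b⟩ := partial1 (fun t r => F r t) h'
  exact ⟨a.comp (contDiff_snd.prodMk contDiff_fst), fun r t => b t r⟩

lemma level_ineq (F : ℝ → ℝ → ℝ)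
    (hsmooth : ContDiff ℝ (⊤ : ℕ∞) (Function.uncurry F))
    (hper : ∀ r, Function.Periodic (F r) (2*π))
    (hlap : ∀ r ∈ Set.Ioo (0:ℝ) π, ∀ θ, sphLap F r θ ≤ F r θ)
    (Ψ ψ : ℝ → ℝ) (dΨ : ∀ z, HasDerivAt Ψ (ψ z) z) (cψ : Continuous ψ)
    (Ψ0 : ∀ z, 0 ≤ Ψ z) (Ψ1 : ∀ z, Ψ z ≤ 1) (ψ0 : ∀ z, 0 ≤ ψ z) :
    π * sphereIntegral (fun r t => Ψ (F r t) ^ 2) ≤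
      (sphereIntegral fun r t => (1 - Ψ (F r t)) * F r t) * (sphereIntegral fun r t => ψ (F r t)) +
      (sphereIntegral fun r t => Ψ (F r t)) ^ 2 := by
  obtain ⟨a1, b1⟩ := partial1 F hsmooth
  obtain ⟨a2, b2⟩ := partial2 F hsmooth
  obtain ⟨a3, b3⟩ := partial1 _ a1
  obtain ⟨a4, b4⟩ := partial2 _ a2
  refine level_ineq' F _ _ _ _ hsmooth.continuous a1.continuous a2.continuous a3.continuous
    a4.continuous b1 b2 b3 b4 (fun r => by simpa using hper r 0) (fun r => ?_) ?_ Ψ ψ dΨ cψ Ψ0 Ψ1 ψ0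
  · have : (fun t => F r (t + 2*π)) = F r := funext (hper r)
    have h2 := deriv_comp_add_const (F r) (2*π) 0
    rw [this, zero_add] at h2
    exact h2.symm
  · intro r hr t
    exact hlap r hr t

lemma smooth_step_deriv : ∃ C : ℝ, ∀ x, |deriv Real.smoothTransition x| ≤ C := by
  have hc : Continuous (deriv Real.smoothTransition) :=
    (Real.smoothTransition.contDiff (n := 1)).continuous_deriv (by simp)
  obtain ⟨C, hC⟩ := (isCompact_Icc (a := (0:ℝ)) (b := 1)).exists_bound_of_continuousOn hc.continuousOn
  refine ⟨max C 0, fun x => ?_⟩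
  by_cases h0 : x < 0
  · have : Real.smoothTransition =ᶠ[nhds x] fun _ => (0:ℝ) := by
      filter_upwards [Iio_mem_nhds h0] with y hy
      exact Real.smoothTransition.zero_of_nonpos (le_of_lt hy)
    rw [this.deriv_eq]; simp
  by_cases h1 : 1 < x
  · have : Real.smoothTransition =ᶠ[nhds x] fun _ => (1:ℝ) := by
      filter_upwards [Ioi_mem_nhds h1] with y hy
      exact Real.smoothTransition.one_of_one_le (le_of_lt hy)
    rw [this.deriv_eq]; simp
  · exact (hC x ⟨not_lt.1 h0, not_lt.1 h1⟩).trans (le_max_left _ _)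

lemma recursion_eps (ν : Measure ℝ) [IsFiniteMeasure ν] (δ B : ℝ) (hδ : 0 < δ)
    (hν : ∀ᵐ x ∂ν, x ∈ Set.Icc δ B) (hB : 0 ≤ B) (h1 : ∫ x, x ∂ν = 1)
    (H : ∀ Ψ ψ : ℝ → ℝ, (∀ z, HasDerivAt Ψ (ψ z) z) → Continuous ψ → (∀ z, 0 ≤ Ψ z) →
      (∀ z, Ψ z ≤ 1) → (∀ z, 0 ≤ ψ z) →
      ∫ x, Ψ x ^ 2 ∂ν ≤ 4 * ((∫ x, (1 - Ψ x) * x ∂ν) * (∫ x, ψ x ∂ν) + (∫ x, Ψ x ∂ν) ^ 2))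
    (p : ℝ) (hp : 2 ≤ p) (ε : ℝ) (hε : 0 < ε) (hεδ : ε < δ) :
    (1 - ε/δ) ^ p * ∫ x, x ^ p ∂ν ≤ 4 * (p * ∫ x, x ^ (p-1) ∂ν) := by
  obtain ⟨C, hC⟩ := smooth_step_deriv
  set S := Real.smoothTransition with hS
  have Sc : Continuous S := Real.smoothTransition.continuous
  have Sd : ∀ x, HasDerivAt S (deriv S x) x := fun x =>
    ((Real.smoothTransition.contDiff (n := 1)).differentiable (by simp) x).hasDerivAt
  have S'c : Continuous (deriv S) :=
    (Real.smoothTransition.contDiff (n := 1)).continuous_deriv (by simp)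
  have S'0 : ∀ x, 0 ≤ deriv S x := fun x => Real.smoothTransition.monotone.deriv_nonneg
  have S0 : ∀ x, 0 ≤ S x := Real.smoothTransition.nonneg
  have S1 : ∀ x, S x ≤ 1 := Real.smoothTransition.le_one
  have Sz : ∀ x ≤ 0, S x = 0 := fun x hx => Real.smoothTransition.zero_of_nonpos hx
  have So : ∀ x, 1 ≤ x → S x = 1 := fun x hx => Real.smoothTransition.one_of_one_le hx
  have S'z : ∀ x < 0, deriv S x = 0 := fun x h0 => by
    have : S =ᶠ[nhds x] fun _ => (0:ℝ) := by
      filter_upwards [Iio_mem_nhds h0] with y hy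
      exact Sz y (le_of_lt hy)
    rw [this.deriv_eq]; simp
  have hC0 : 0 ≤ C := (abs_nonneg _).trans (hC 0)
  clear_value S
  have ci : ∀ g : ℝ → ℝ, Continuous g → ∀ a b, IntervalIntegrable g volume a b :=
    fun g hg a b => hg.intervalIntegrable a b
  -- integrability of continuous functions
  have ni : ∀ g : ℝ → ℝ, Continuous g → Integrable g ν := by
    intro g hg
    obtain ⟨M, hM⟩ := (isCompact_Icc (a := δ) (b := B)).exists_bound_of_continuousOn hg.continuousOn
    exact Integrable.of_bound hg.aestronglyMeasurable M (hν.mono hM)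
  set u : ℝ → ℝ → ℝ := fun t x => S ((x - t)/ε) with hu
  set w : ℝ → ℝ → ℝ := fun t x => deriv S ((x - t)/ε) / ε with hw
  have uc : Continuous (Function.uncurry u) := by
    simp only [Function.uncurry_def, hu]; fun_prop
  have wc : Continuous (Function.uncurry w) := by
    simp only [Function.uncurry_def, hw]; fun_prop
  have ucx : ∀ t, Continuous (u t) := fun t => by simp only [hu]; fun_prop
  have wcx : ∀ t, Continuous (w t) := fun t => by simp only [hw]; fun_prop
  have wct : ∀ x, Continuous fun t => w t x := fun t => by simp only [hw]; fun_prop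
  have uct : ∀ x, Continuous fun t => u t x := fun t => by simp only [hu]; fun_prop
  have w0 : ∀ t x, 0 ≤ w t x := fun t x => div_nonneg (S'0 _) hε.le
  have wb : ∀ t x, |w t x| ≤ C / ε := fun t x => by
    simp only [hw]; rw [abs_div, abs_of_pos hε]; gcongr; exact hC _
  have u0 : ∀ t x, 0 ≤ u t x := fun t x => S0 _
  have u1 : ∀ t x, u t x ≤ 1 := fun t x => S1 _
  have dux : ∀ t x, HasDerivAt (u t) (w t x) x := fun t x => by
    have := (Sd ((x-t)/ε)).comp x (((hasDerivAt_id x).sub_const t).div_const ε)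
    exact this.congr_deriv (by simp only [hw]; ring)
  have dut : ∀ t x, HasDerivAt (fun t => u t x) (-w t x) t := fun t x => by
    have := (Sd ((x-t)/ε)).comp t (((hasDerivAt_id t).const_sub x).div_const ε)
    exact this.congr_deriv (by simp only [hw]; ring)
  set s : ℝ → ℝ := fun t => ∫ x, u t x ∂ν with hs
  set G : ℝ → ℝ := fun t => ∫ x, w t x ∂ν with hG
  set q : ℝ → ℝ := fun t => ∫ x, u t x ^ 2 ∂ν with hq
  have Gc : Continuous G := continuous_of_dominated (bound := fun _ => C/ε)
    (fun t => (wcx t).aestronglyMeasurable) (fun t => .of_forall fun x => wb t x)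
    (integrable_const _) (.of_forall fun x => wct x)
  have qc : Continuous q := continuous_of_dominated (bound := fun _ => 1)
    (fun t => ((ucx t).pow 2).aestronglyMeasurable) (fun t => .of_forall fun x => by
      rw [Real.norm_eq_abs, abs_of_nonneg (by positivity)]; exact pow_le_one₀ (u0 t x) (u1 t x))
    (integrable_const _) (.of_forall fun x => (uct x).pow 2)
  have sd : ∀ t, HasDerivAt s (-G t) t := by
    intro t
    have := (hasDerivAt_integral_of_dominated_loc_of_deriv_le (μ := ν) (F := u) (F' := fun t x => - w t x)
      (s := Set.univ) (x₀ := t) (bound := fun _ => C/ε) Filter.univ_mem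
      (.of_forall fun t => (ucx t).aestronglyMeasurable) (ni _ (ucx t))
      (wcx t).neg.aestronglyMeasurable
      (.of_forall fun x t _ => by rw [norm_neg]; exact wb t x) (integrable_const _)
      (.of_forall fun x t _ => dut t x)).2
    rw [MeasureTheory.integral_neg] at this
    exact this
  have sc : Continuous s := continuous_iff_continuousAt.2 fun r => (sd r).continuousAt
  have s0 : ∀ t, 0 ≤ s t := fun t => integral_nonneg (u0 t)
  have G0 : ∀ t, 0 ≤ G t := fun t => integral_nonneg (w0 t)
  -- the level inequality
  have star : ∀ t, 0 ≤ t → q t ≤ 4 * ((1 - t * s t) * G t + s t ^ 2) := by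
    intro t ht
    have h := H (u t) (w t) (dux t) (wcx t) (u0 t) (u1 t) (w0 t)
    have hJ : ∫ x, (1 - u t x) * x ∂ν ≤ 1 - t * s t := by
      have e1 : ∫ x, (1 - u t x) * x ∂ν = 1 - ∫ x, u t x * x ∂ν := by
        have i1 : Integrable (fun x : ℝ => x) ν := ni _ continuous_id
        have i2 : Integrable (fun x : ℝ => u t x * x) ν := ni _ ((ucx t).mul continuous_id)
        have := MeasureTheory.integral_sub i1 i2
        rw [h1] at this
        rw [← this]
        congr 1; ext x; ring
      have e2 : t * s t ≤ ∫ x, u t x * x ∂ν := by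
        rw [hs, ← MeasureTheory.integral_const_mul]
        apply integral_mono (ni _ (continuous_const.mul (ucx t))) (ni _ ((ucx t).mul continuous_id))
        intro x
        simp only
        rcases le_or_gt x t with hx | hx
        · have : u t x = 0 := Sz _ (div_nonpos_of_nonpos_of_nonneg (by linarith) hε.le)
          simp [this]
        · rw [mul_comm]; exact mul_le_mul_of_nonneg_left hx.le (u0 t x)
      linarith
    have := mul_le_mul_of_nonneg_right hJ (G0 t)
    change q t ≤ 4 * (_ * G t + s t ^ 2) at h
    linarith
  have pc : Continuous fun t : ℝ => t ^ (p-1) := continuous_id.rpow_const (fun _ => Or.inr (by linarith))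
  have pc' : Continuous fun t : ℝ => t ^ p := continuous_id.rpow_const (fun _ => Or.inr (by linarith))
  have dp : ∀ t : ℝ, HasDerivAt (fun t : ℝ => t ^ p) (p * t ^ (p-1)) t := fun t =>
    Real.hasDerivAt_rpow_const (Or.inr (by linarith))
  have sB : s B = 0 := by
    have : ∀ᵐ x ∂ν, u B x = 0 := hν.mono fun x hx =>
      Sz _ (div_nonpos_of_nonpos_of_nonneg (by linarith [hx.2]) hε.le)
    rw [hs]; simp only; rw [integral_congr_ae this]; simp
  -- integration by parts
  have ibp : ∫ t in (0:ℝ)..B, p * t ^ (p-1) * s t ^ 2 = 2 * ∫ t in (0:ℝ)..B, t ^ p * (s t * G t) := by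
    have := integral_eq_sub_of_hasDerivAt (a := 0) (b := B) (f := fun t => t ^ p * s t ^ 2)
      (f' := fun t => p * t ^ (p-1) * s t ^ 2 - 2 * (t ^ p * (s t * G t)))
      (fun t _ => ((dp t).mul ((sd t).pow 2)).congr_deriv (by simp only [Pi.pow_apply]; push_cast; ring))
      (ci _ (by fun_prop) _ _)
    rw [intervalIntegral.integral_sub (ci _ (by fun_prop) _ _) (ci _ (by fun_prop) _ _),
      intervalIntegral.integral_const_mul, sB, Real.zero_rpow (by linarith)] at this
    linarith
  have main : ∫ t in (0:ℝ)..B, p * t ^ (p-1) * q t ≤ 4 * ∫ t in (0:ℝ)..B, p * t ^ (p-1) * G t := by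
    have m1 : ∫ t in (0:ℝ)..B, p * t ^ (p-1) * q t ≤ ∫ t in (0:ℝ)..B,
        ((4 * (p * t ^ (p-1) * G t) - 4 * p * (t ^ p * (s t * G t))) + 4 * (p * t ^ (p-1) * s t ^ 2)) := by
      apply intervalIntegral.integral_mono_on hB (ci _ (by fun_prop) _ _) (ci _ (by fun_prop) _ _)
      intro t ht
      have a := mul_le_mul_of_nonneg_left (star t ht.1)
        (mul_nonneg (by linarith : (0:ℝ) ≤ p) (Real.rpow_nonneg ht.1 (p-1)))
      have e : t ^ p = t ^ (p-1) * t := by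
        rw [← Real.rpow_add_one' ht.1 (by linarith)]; congr 1; ring
      rw [e]
      calc _ ≤ _ := a
        _ = _ := by ring
    rw [intervalIntegral.integral_add (ci _ (by fun_prop) _ _) (ci _ (by fun_prop) _ _),
      intervalIntegral.integral_sub (ci _ (by fun_prop) _ _) (ci _ (by fun_prop) _ _)] at m1
    rw [intervalIntegral.integral_const_mul, intervalIntegral.integral_const_mul,
      intervalIntegral.integral_const_mul, ibp] at m1
    have m2 : 0 ≤ ∫ t in (0:ℝ)..B, t ^ p * (s t * G t) :=
      intervalIntegral.integral_nonneg hB fun t ht =>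
        mul_nonneg (Real.rpow_nonneg ht.1 _) (mul_nonneg (s0 t) (G0 t))
    nlinarith
  -- Fubini
  have fub : ∀ g : ℝ → ℝ → ℝ, Continuous (Function.uncurry g) → (∃ M, ∀ t x, |g t x| ≤ M) →
      ∫ t in (0:ℝ)..B, p * t ^ (p-1) * ∫ x, g t x ∂ν =
        ∫ x, (∫ t in (0:ℝ)..B, p * t ^ (p-1) * g t x) ∂ν := by
    rintro g hg ⟨M, hM⟩
    simp only [← MeasureTheory.integral_const_mul]
    apply intervalIntegral_integral_swap
    have hc : Continuous (Function.uncurry fun t x => p * t ^ (p-1) * g t x) :=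
      ((continuous_const.mul (pc.comp continuous_fst)).mul hg)
    have : IsFiniteMeasure (volume.restrict (Set.uIoc 0 B)) :=
      ⟨by rw [Measure.restrict_apply_univ, Set.uIoc_of_le hB]; exact measure_Ioc_lt_top⟩
    refine Integrable.of_bound hc.aestronglyMeasurable (p * B ^ (p-1) * M) ?_
    have : ∀ᵐ z : ℝ × ℝ ∂((volume.restrict (Set.uIoc 0 B)).prod ν), z.1 ∈ Set.uIoc 0 B := 
      Measure.quasiMeasurePreserving_fst.ae (ae_restrict_mem measurableSet_uIoc)
    filter_upwards [this] with z hz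
    rw [Set.uIoc_of_le hB] at hz
    obtain ⟨t, x⟩ := z
    simp only [Function.uncurry_apply_pair] at *
    rw [Real.norm_eq_abs, abs_mul, abs_of_nonneg (mul_nonneg (by linarith) (Real.rpow_nonneg hz.1.le _))]
    have : t ^ (p-1) ≤ B ^ (p-1) := Real.rpow_le_rpow hz.1.le hz.2 (by linarith)
    have hM0 : 0 ≤ M := (abs_nonneg _).trans (hM 0 0)
    have hp0 : 0 ≤ p := by linarith
    have := Real.rpow_nonneg hz.1.le (p-1)
    have := hM t x
    gcongr
  have upper : ∫ t in (0:ℝ)..B, p * t ^ (p-1) * G t ≤ p * ∫ x, x ^ (p-1) ∂ν := by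
    rw [fub w wc ⟨_, wb⟩, ← MeasureTheory.integral_const_mul]
    have c1 : Continuous fun x => ∫ t in (0:ℝ)..B, p * t ^ (p-1) * w t x :=
      cont_param' (fun t x => p * t ^ (p-1) * w t x)
        ((continuous_const.mul (pc.comp continuous_fst)).mul wc) _ _
    apply integral_mono_ae (ni _ c1) (ni _ (by fun_prop))
    filter_upwards [hν] with x hx
    have hx0 : 0 ≤ x := hδ.le.trans hx.1
    have a : ∫ t in (0:ℝ)..B, p * t ^ (p-1) * w t x ≤ ∫ t in (0:ℝ)..B, p * x ^ (p-1) * w t x := by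
      have := wct x
      apply intervalIntegral.integral_mono_on hB (ci _ (by fun_prop) _ _) (ci _ (by fun_prop) _ _)
      intro t ht
      rcases le_or_gt t x with h | h
      · have := w0 t x
        have := Real.rpow_le_rpow ht.1 h (by linarith : 0 ≤ p - 1)
        have hp0 : 0 ≤ p := by linarith
        gcongr
      · have : w t x = 0 := by
          simp only [hw]; rw [S'z _ (div_neg_of_neg_of_pos (by linarith) hε)]; simp
        simp [this]
    have b : ∫ t in (0:ℝ)..B, w t x ≤ 1 := by
      have := integral_eq_sub_of_hasDerivAt (a := 0) (b := B) (f := fun t => - u t x) (f' := fun t => w t x)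
        (fun t _ => (dut t x).neg.congr_deriv (neg_neg _)) (ci _ (wct x) _ _)
      rw [this]
      have := u0 B x
      have := u1 0 x
      linarith
    rw [intervalIntegral.integral_const_mul] at a
    refine a.trans ?_
    exact mul_le_of_le_one_right (mul_nonneg (by linarith) (Real.rpow_nonneg hx0 _)) b
  have lower : (1 - ε/δ) ^ p * ∫ x, x ^ p ∂ν ≤ ∫ t in (0:ℝ)..B, p * t ^ (p-1) * q t := by
    have uc2 : Continuous (Function.uncurry fun t x => u t x ^ 2) := uc.pow 2
    rw [fub (fun t x => u t x ^ 2) uc2 ⟨1, fun t x => by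
      rw [abs_of_nonneg (by positivity)]; exact pow_le_one₀ (u0 t x) (u1 t x)⟩, ← MeasureTheory.integral_const_mul]
    have c1 : Continuous fun x => ∫ t in (0:ℝ)..B, p * t ^ (p-1) * u t x ^ 2 :=
      cont_param' (fun t x => p * t ^ (p-1) * u t x ^ 2)
        (by
          have a : Continuous fun q : ℝ × ℝ => u q.1 q.2 := uc
          have b : Continuous fun q : ℝ × ℝ => q.1 ^ (p-1) := pc.comp continuous_fst
          simp only [Function.uncurry_def]
          fun_prop) _ _
    apply integral_mono_ae (ni _ (by fun_prop)) (ni _ c1)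
    filter_upwards [hν] with x hx
    have hx0 : 0 ≤ x := hδ.le.trans hx.1
    have cu := uct x
    have k1 : 0 ≤ 1 - ε/δ := by rw [sub_nonneg, div_le_one hδ]; exact hεδ.le
    have k2 : (1 - ε/δ) * x ≤ x - ε := by
      have : ε ≤ ε / δ * x := by
        rw [div_mul_eq_mul_div, le_div_iff₀ hδ]; exact mul_le_mul_of_nonneg_left hx.1 hε.le
      linarith
    have xe : 0 ≤ x - ε := by linarith [hx.1]
    have xB : x - ε ≤ B := by linarith [hx.2]
    calc (1 - ε/δ) ^ p * x ^ p = ((1 - ε/δ) * x) ^ p := (Real.mul_rpow k1 hx0).symm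
      _ ≤ (x - ε) ^ p := Real.rpow_le_rpow (mul_nonneg k1 hx0) k2 (by linarith)
      _ = ∫ t in (0:ℝ)..(x-ε), p * t ^ (p-1) := by
        rw [integral_eq_sub_of_hasDerivAt (fun t _ => dp t) (ci _ (by fun_prop) _ _),
          Real.zero_rpow (by linarith), sub_zero]
      _ = ∫ t in (0:ℝ)..(x-ε), p * t ^ (p-1) * u t x ^ 2 := by
        apply intervalIntegral.integral_congr
        intro t ht
        rw [Set.uIcc_of_le xe] at ht
        have : u t x = 1 := So _ (by rw [le_div_iff₀ hε]; linarith [ht.2])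
        simp [this]
      _ ≤ (∫ t in (0:ℝ)..(x-ε), p * t ^ (p-1) * u t x ^ 2) + ∫ t in (x-ε)..B, p * t ^ (p-1) * u t x ^ 2 := by
        have : 0 ≤ ∫ t in (x-ε)..B, p * t ^ (p-1) * u t x ^ 2 :=
          intervalIntegral.integral_nonneg xB fun t ht =>
            mul_nonneg (mul_nonneg (by linarith) (Real.rpow_nonneg (xe.trans ht.1) _)) (sq_nonneg _)
        linarith
      _ = _ := intervalIntegral.integral_add_adjacent_intervals (ci _ (by fun_prop) _ _) (ci _ (by fun_prop) _ _)
  linarith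

lemma recursion (ν : Measure ℝ) [IsFiniteMeasure ν] (δ B : ℝ) (hδ : 0 < δ)
    (hν : ∀ᵐ x ∂ν, x ∈ Set.Icc δ B) (hB : 0 ≤ B) (h1 : ∫ x, x ∂ν = 1)
    (H : ∀ Ψ ψ : ℝ → ℝ, (∀ z, HasDerivAt Ψ (ψ z) z) → Continuous ψ → (∀ z, 0 ≤ Ψ z) →
      (∀ z, Ψ z ≤ 1) → (∀ z, 0 ≤ ψ z) →
      ∫ x, Ψ x ^ 2 ∂ν ≤ 4 * ((∫ x, (1 - Ψ x) * x ∂ν) * (∫ x, ψ x ∂ν) + (∫ x, Ψ x ∂ν) ^ 2))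
    (p : ℝ) (hp : 2 ≤ p) :
    ∫ x, x ^ p ∂ν ≤ 4 * (p * ∫ x, x ^ (p-1) ∂ν) := by
  have lim : Filter.Tendsto (fun ε : ℝ => (1 - ε/δ) ^ p * ∫ x, x ^ p ∂ν) (nhdsWithin 0 (Set.Ioi 0))
      (nhds ((1 - 0/δ) ^ p * ∫ x, x ^ p ∂ν)) := by
    have : Continuous (fun ε : ℝ => (1 - ε/δ) ^ p * ∫ x, x ^ p ∂ν) :=
      (Continuous.rpow_const (by fun_prop) (fun _ => Or.inr (by linarith))).mul continuous_const
    exact (this.tendsto 0).mono_left nhdsWithin_le_nhds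
  rw [zero_div, sub_zero, Real.one_rpow, one_mul] at lim
  refine le_of_tendsto lim ?_
  filter_upwards [Ioo_mem_nhdsGT hδ] with ε hε
  exact recursion_eps ν δ B hδ hν hB h1 H p hp ε hε.1 hε.2

lemma moments (ν : Measure ℝ) [IsFiniteMeasure ν] (δ B : ℝ) (hδ : 0 < δ)
    (hν : ∀ᵐ x ∂ν, x ∈ Set.Icc δ B) (h1 : ∫ x, x ∂ν = 1)
    (R : ∀ p : ℝ, 2 ≤ p → ∫ x, x ^ p ∂ν ≤ 4 * (p * ∫ x, x ^ (p-1) ∂ν)) (p : ℝ) (hp : 1 ≤ p) :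
    ∫ x, x ^ p ∂ν ≤ exp (p + p^2/4) := by
  have ni : ∀ p : ℝ, 1 ≤ p → Integrable (fun x : ℝ => x ^ p) ν := by
    intro p hp
    have hg : Continuous fun x : ℝ => x ^ p := continuous_id.rpow_const (fun _ => Or.inr (by linarith))
    obtain ⟨M, hM⟩ := (isCompact_Icc (a := δ) (b := B)).exists_bound_of_continuousOn hg.continuousOn
    exact Integrable.of_bound hg.aestronglyMeasurable M (hν.mono hM)
  have M1 : ∫ x, x ^ (1:ℝ) ∂ν = 1 := by simpa using h1
  have M2 := R 2 (by norm_num)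
  have M3 := R 3 (by norm_num)
  have M4 := R 4 (by norm_num)
  have M5 := R 5 (by norm_num)
  norm_num only at M2 M3 M4 M5
  rw [M1] at M2
  have he := Real.exp_one_gt_d9
  have M5' : ∫ x, x ^ (5:ℝ) ∂ν ≤ exp 10.4 := by
    have : (30720:ℝ) ≤ exp 10.4 := by
      have e : exp 10.4 = exp 1 ^ 10 * exp 0.4 := by
        rw [← Real.exp_nat_mul, ← Real.exp_add]; norm_num
      have e2 : (1.4:ℝ) ≤ exp 0.4 := by have := Real.add_one_le_exp (0.4:ℝ); linarith
      rw [e]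
      calc (30720:ℝ) ≤ 2.718 ^ 10 * 1.4 := by norm_num
        _ ≤ exp 1 ^ 10 * exp 0.4 := by gcongr; linarith
    linarith
  have base : ∀ p : ℝ, 1 ≤ p → p ≤ 5 → ∫ x, x ^ p ∂ν ≤ exp (p + p^2/4) := by
    intro p hp hp5
    set A := exp 10.4 with hA
    have A0 : 0 < A := Real.exp_pos _
    set θ := (p-1)/4 with hθ
    have i1 := ni 1 le_rfl
    have i5 := ni 5 (by norm_num)
    have k : ∫ x, x ^ p ∂ν ≤ ∫ x, A ^ θ * ((1-θ) * x ^ (1:ℝ) + θ * (x ^ (5:ℝ) / A)) ∂ν := by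
      apply integral_mono_ae (ni p hp)
        (((i1.const_mul (1-θ)).add ((i5.div_const A).const_mul θ)).const_mul (A ^ θ))
      filter_upwards [hν] with x hx
      have hx0 : 0 < x := hδ.trans_le hx.1
      have g := Real.geom_mean_le_arith_mean2_weighted (w₁ := 1-θ) (w₂ := θ) (p₁ := x ^ (1:ℝ)) (p₂ := x ^ (5:ℝ) / A)
        (by rw [hθ]; linarith) (by rw [hθ]; linarith) (by positivity) (by positivity) (by ring)
      have e : x ^ p = A ^ θ * ((x ^ (1:ℝ)) ^ (1-θ) * (x ^ (5:ℝ) / A) ^ θ) := by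
        rw [Real.div_rpow (by positivity) A0.le, ← Real.rpow_mul hx0.le, ← Real.rpow_mul hx0.le]
        have : A ^ θ ≠ 0 := by positivity
        field_simp
        rw [← Real.rpow_add hx0]
        congr 1; rw [hθ]; ring
      rw [e]
      change _ ≤ A ^ θ * ((1-θ) * x ^ (1:ℝ) + θ * (x ^ (5:ℝ) / A))
      gcongr
    refine k.trans ?_
    rw [MeasureTheory.integral_const_mul,
      MeasureTheory.integral_add (i1.const_mul (1-θ)) ((i5.div_const A).const_mul θ),
      MeasureTheory.integral_const_mul, MeasureTheory.integral_const_mul, MeasureTheory.integral_div, M1]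
    have a1 : (∫ x, x ^ (5:ℝ) ∂ν) / A ≤ 1 := by rw [div_le_one A0]; exact M5'
    have a2 : 0 ≤ θ := by rw [hθ]; linarith
    have a3 : (1-θ) * 1 + θ * ((∫ x, x ^ (5:ℝ) ∂ν) / A) ≤ 1 := by nlinarith
    calc A ^ θ * ((1-θ) * 1 + θ * ((∫ x, x ^ (5:ℝ) ∂ν) / A)) ≤ A ^ θ * 1 := by gcongr
      _ = exp (10.4 * θ) := by rw [mul_one, hA, ← Real.exp_mul]
      _ ≤ exp (p + p^2/4) := by
        apply Real.exp_le_exp.2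
        rw [hθ]; nlinarith [sq_nonneg (p - 3.2)]
  have step : ∀ n : ℕ, ∀ p : ℝ, 1 ≤ p → p ≤ 5 + n → ∫ x, x ^ p ∂ν ≤ exp (p + p^2/4) := by
    intro n
    induction n with
    | zero => intro p hp h; exact base p hp (by simpa using h)
    | succ n ih =>
      intro p hp h
      push_cast at h
      by_cases h5 : p ≤ 5
      · exact base p hp h5
      push Not at h5
      have a := R p (by linarith)
      have b := ih (p-1) (by linarith) (by linarith)
      have c : 4 * p ≤ exp (3/4 + p/2) := by
        have e : exp (3/4 + p/2) = exp 1 ^ 3 * exp (1/4) * exp ((p-5)/2) := by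
          rw [← Real.exp_nat_mul, ← Real.exp_add, ← Real.exp_add]; congr 1; push_cast; ring
        have e2 := Real.add_one_le_exp ((1/4:ℝ))
        have e3 := Real.add_one_le_exp ((p-5)/2)
        have e4 : (20:ℝ) ≤ exp 1 ^ 3 * exp (1/4) := by
          calc (20:ℝ) ≤ 2.718 ^ 3 * (1/4 + 1) := by norm_num
            _ ≤ exp 1 ^ 3 * exp (1/4) := by gcongr; linarith
        rw [e]
        calc 4 * p ≤ 20 * ((p-5)/2 + 1) := by linarith
          _ ≤ _ := by
            have : 0 ≤ (p-5)/2 + 1 := by linarith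
            gcongr
      calc ∫ x, x ^ p ∂ν ≤ 4 * p * ∫ x, x ^ (p-1) ∂ν := by linarith
        _ ≤ 4 * p * exp ((p-1) + (p-1)^2/4) := by gcongr
        _ ≤ exp (3/4 + p/2) * exp ((p-1) + (p-1)^2/4) := by gcongr
        _ = exp (p + p^2/4) := by rw [← Real.exp_add]; congr 1; ring
  obtain ⟨n, hn⟩ := exists_nat_ge p
  exact step n p hp (by linarith)

lemma law_exists (F : ℝ → ℝ → ℝ) (cF : Continuous (Function.uncurry F)) (hpos : ∀ r θ, 0 < F r θ) :
    ∃ (ν : Measure ℝ) (δ B : ℝ), IsFiniteMeasure ν ∧ 0 < δ ∧ 0 ≤ B ∧ (∀ᵐ x ∂ν, x ∈ Set.Icc δ B) ∧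
      ∀ g : ℝ → ℝ, Continuous g → 4 * π * ∫ x, g x ∂ν = sphereIntegral fun r t => g (F r t) := by
  have hpi := Real.pi_pos
  have p2 : (0:ℝ) ≤ 2 * π := by positivity
  set K : Set (ℝ × ℝ) := Set.Icc 0 π ×ˢ Set.Icc 0 (2*π) with hK
  have Kc : IsCompact K := isCompact_Icc.prod isCompact_Icc
  have Kn : K.Nonempty := ⟨(0,0), ⟨⟨le_rfl, hpi.le⟩, ⟨le_rfl, p2⟩⟩⟩
  obtain ⟨z, _, hz⟩ := Kc.exists_isMinOn Kn cF.continuousOn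
  obtain ⟨y, _, hy⟩ := Kc.exists_isMaxOn Kn cF.continuousOn
  set μ : Measure (ℝ × ℝ) := (volume.restrict (Set.Ioc 0 π)).prod (volume.restrict (Set.Ioc 0 (2*π))) with hμ
  have hμK : ∀ᵐ q ∂μ, q ∈ K ∧ q.1 ∈ Set.Ioc 0 π := by
    have a1 : ∀ᵐ q : ℝ × ℝ ∂μ, q.1 ∈ Set.Ioc 0 π :=
      Measure.quasiMeasurePreserving_fst.ae (ae_restrict_mem measurableSet_Ioc)
    have a2 : ∀ᵐ q : ℝ × ℝ ∂μ, q.2 ∈ Set.Ioc 0 (2*π) :=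
      Measure.quasiMeasurePreserving_snd.ae (ae_restrict_mem measurableSet_Ioc)
    filter_upwards [a1, a2] with q h1 h2
    exact ⟨⟨⟨h1.1.le, h1.2⟩, ⟨h2.1.le, h2.2⟩⟩, h1⟩
  have mi : ∀ g : ℝ × ℝ → ℝ, Continuous g → Integrable g μ := by
    intro g hg
    obtain ⟨M, hM⟩ := Kc.exists_bound_of_continuousOn hg.continuousOn
    exact Integrable.of_bound hg.aestronglyMeasurable M (hμK.mono fun q hq => hM q hq.1)
  set d : ℝ × ℝ → ℝ := fun q => sin q.1 / (4*π) with hd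
  have cd : Continuous d := by simp only [hd]; fun_prop
  set P := μ.withDensity fun q => ENNReal.ofReal (d q) with hP
  have finP : IsFiniteMeasure P := isFiniteMeasure_withDensity_ofReal (mi d cd).2
  have cm : Measurable (Function.uncurry F) := cF.measurable
  refine ⟨P.map (Function.uncurry F), Function.uncurry F z, Function.uncurry F y, inferInstance,
    hpos _ _, (hpos _ _).le, ?_, ?_⟩
  · refine (ae_map_iff cm.aemeasurable measurableSet_Icc).2 ?_
    have : ∀ᵐ q ∂P, q ∈ K ∧ q.1 ∈ Set.Ioc 0 π := (withDensity_absolutelyContinuous _ _).ae_le hμK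
    filter_upwards [this] with q hq
    exact ⟨hz hq.1, hy hq.1⟩
  · intro g hg
    rw [integral_map cm.aemeasurable hg.aestronglyMeasurable, hP,
      integral_withDensity_eq_integral_toReal_smul (by fun_prop) (by simp)]
    have e1 : ∫ q, (ENNReal.ofReal (d q)).toReal • g (Function.uncurry F q) ∂μ =
        ∫ q, d q * g (Function.uncurry F q) ∂μ := by
      apply MeasureTheory.integral_congr_ae
      filter_upwards [hμK] with q hq
      rw [ENNReal.toReal_ofReal, smul_eq_mul]
      have := sin_nonneg_of_mem_Icc ⟨hq.2.1.le, hq.2.2⟩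
      simp only [hd]; positivity
    rw [e1, ← MeasureTheory.integral_const_mul, hμ, integral_prod]
    · simp only [sphereIntegral]
      rw [intervalIntegral.integral_of_le hpi.le]
      congr 1; ext r
      rw [intervalIntegral.integral_of_le p2]
      congr 1; ext t
      simp only [hd, Function.uncurry_apply_pair]
      field_simp
    · exact mi _ (continuous_const.mul (cd.mul (hg.comp cF)))

/-- Moser–Trudinger `L^p` bound. If `f > 0` is smooth on `S²` with `Δf ≤ f`
and `∫_{S²} f dvol ≤ V/(2π)` for some `V > 0`, then for every `p ∈ [1, ∞)`,
`∫_{S²} f^p dvol ≤ 4π exp(Vp/(8π²) + p²/4)`. -/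
theorem Lp_bound_of_volume (F : ℝ → ℝ → ℝ) (V : ℝ) (hV : 0 < V)
    (hsmooth : ContDiff ℝ (⊤ : ℕ∞) (Function.uncurry F))
    (hper : ∀ r, Function.Periodic (F r) (2*π))
    (hpole₀ : ∀ θ₁ θ₂, F 0 θ₁ = F 0 θ₂)
    (hpoleπ : ∀ θ₁ θ₂, F π θ₁ = F π θ₂)
    (hpos : ∀ r θ, 0 < F r θ)
    (hlap : ∀ r ∈ Set.Ioo (0:ℝ) π, ∀ θ, sphLap F r θ ≤ F r θ)
    (hvol : sphereIntegral F ≤ V/(2*π)) :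
    ∀ p : ℝ, 1 ≤ p →
      sphereIntegral (fun r θ => F r θ ^ p) ≤ 4*π * Real.exp (V*p/(8*π^2) + p^2/4) := by
  intro p hp
  have hpi := Real.pi_pos
  have cF : Continuous (Function.uncurry F) := hsmooth.continuous
  set m := sphereIntegral F / (4*π) with hm
  have m0 : 0 < m := by
    obtain ⟨ν, δ, B, hfin, hδ, hB, hν, law⟩ := law_exists F cF hpos
    have a1 := law (fun _ => 1) continuous_const
    have a2 := law (fun x => x) continuous_id
    have a3 : sphereIntegral (fun _ _ => (1:ℝ)) = 4 * π := by
      simp only [sphereIntegral, one_mul, intervalIntegral.integral_const, smul_eq_mul, sub_zero,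
        intervalIntegral.integral_const_mul, integral_sin, cos_zero, cos_pi]
      ring
    rw [a3] at a1
    have a4 : ∫ _x, (1:ℝ) ∂ν = 1 := by
      have : (4 * π) * ∫ _x, (1:ℝ) ∂ν = (4 * π) * 1 := by rw [a1, mul_one]
      exact mul_left_cancel₀ (by positivity) this
    have i1 : Integrable (fun x : ℝ => x) ν :=
      Integrable.of_bound continuous_id.aestronglyMeasurable B (hν.mono fun x hx => by
        rw [Real.norm_eq_abs, abs_of_nonneg (hδ.le.trans hx.1)]; exact hx.2)
    have a5 : δ ≤ ∫ x, x ∂ν := by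
      calc δ = ∫ _x, δ * 1 ∂ν := by rw [MeasureTheory.integral_const_mul, a4, mul_one]
        _ ≤ ∫ x, x ∂ν := integral_mono_ae (integrable_const _) i1 (hν.mono fun x hx => by
          simpa using hx.1)
    have : sphereIntegral F = 4 * π * ∫ x, x ∂ν := a2.symm
    rw [hm, this]
    have : 0 < ∫ x, x ∂ν := hδ.trans_le a5
    positivity
  have cG : Continuous (Function.uncurry fun r t => F r t / m) := cF.div_const m
  obtain ⟨ν, δ, B, hfin, hδ, hB, hν, law⟩ := law_exists (fun r t => F r t / m) cG
    (fun r t => div_pos (hpos r t) m0)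
  have p4 : 0 < 4 * π := by positivity
  have hcancel : ∀ x : ℝ, m * (x / m) = x := fun x => by field_simp
  have h1 : ∫ x, x ∂ν = 1 := by
    have a := law (fun x => m * x) (by fun_prop)
    simp only [hcancel] at a
    rw [MeasureTheory.integral_const_mul] at a
    have b : sphereIntegral F = 4 * π * m := by rw [hm]; field_simp
    rw [show (sphereIntegral fun r t => F r t) = 4 * π * m from b] at a
    have : (4 * π * m) * ∫ x, x ∂ν = (4 * π * m) * 1 := by linarith
    exact mul_left_cancel₀ (by positivity) this
  have H : ∀ Ψ ψ : ℝ → ℝ, (∀ z, HasDerivAt Ψ (ψ z) z) → Continuous ψ → (∀ z, 0 ≤ Ψ z) →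
      (∀ z, Ψ z ≤ 1) → (∀ z, 0 ≤ ψ z) →
      ∫ x, Ψ x ^ 2 ∂ν ≤ 4 * ((∫ x, (1 - Ψ x) * x ∂ν) * (∫ x, ψ x ∂ν) + (∫ x, Ψ x ∂ν) ^ 2) := by
    intro Ψ ψ dΨ cψ Ψ0 Ψ1 ψ0
    have cΨ : Continuous Ψ := continuous_iff_continuousAt.2 fun r => (dΨ r).continuousAt
    have a := level_ineq F hsmooth hper hlap (fun z => Ψ (z / m)) (fun z => m⁻¹ * ψ (z / m))
      (fun z => ((dΨ (z/m)).comp z ((hasDerivAt_id z).div_const m)).congr_deriv (by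
        rw [one_div, mul_comm]))
      (by fun_prop) (fun z => Ψ0 _) (fun z => Ψ1 _)
      (fun z => mul_nonneg (inv_nonneg.2 m0.le) (ψ0 _))
    have l1 := law (fun x => Ψ x ^ 2) (by fun_prop)
    have l2 := law (fun x => m * ((1 - Ψ x) * x)) (by fun_prop)
    have l3 := law (fun x => m⁻¹ * ψ x) (by fun_prop)
    have l4 := law Ψ cΨ
    have l2' : (fun r t : ℝ => m * ((1 - Ψ (F r t / m)) * (F r t / m))) =
        fun r t => (1 - Ψ (F r t / m)) * F r t := by
      ext r t
      rw [mul_left_comm, hcancel]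
    rw [l2'] at l2
    rw [← l1, ← l2, ← l3, ← l4, MeasureTheory.integral_const_mul,
      MeasureTheory.integral_const_mul] at a
    have e : 4 * π * (m * ∫ x, (1 - Ψ x) * x ∂ν) * (4 * π * (m⁻¹ * ∫ x, ψ x ∂ν)) +
        (4 * π * ∫ x, Ψ x ∂ν) ^ 2 =
        (4 * π^2) * (4 * ((∫ x, (1 - Ψ x) * x ∂ν) * (∫ x, ψ x ∂ν) + (∫ x, Ψ x ∂ν) ^ 2)) := by
      field_simp
    rw [e] at a
    have : (4 * π^2) * ∫ x, Ψ x ^ 2 ∂ν ≤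
        (4 * π^2) * (4 * ((∫ x, (1 - Ψ x) * x ∂ν) * (∫ x, ψ x ∂ν) + (∫ x, Ψ x ∂ν) ^ 2)) := by
      linarith
    exact le_of_mul_le_mul_left this (by positivity)
  have mom := moments ν δ B hδ hν h1 (recursion ν δ B hδ hν hB h1 H) p hp
  have cp : Continuous fun x : ℝ => m ^ p * x ^ p :=
    continuous_const.mul (continuous_id.rpow_const (fun _ => Or.inr (by linarith)))
  have fin := law _ cp
  have e : (fun r t : ℝ => m ^ p * (F r t / m) ^ p) = fun r t => F r t ^ p := by
    ext r t
    rw [← Real.mul_rpow m0.le (div_nonneg (hpos r t).le m0.le), hcancel]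
  rw [e, MeasureTheory.integral_const_mul] at fin
  rw [← fin]
  have mp : m ^ p ≤ exp (p * (m - 1)) := by
    have : m ≤ exp (m - 1) := by have := Real.add_one_le_exp (m-1); linarith
    calc m ^ p ≤ (exp (m-1)) ^ p := Real.rpow_le_rpow m0.le this (by linarith)
      _ = _ := by rw [← Real.exp_mul, mul_comm]
  have mV : m ≤ V / (8*π^2) := by
    rw [hm, div_le_iff₀ p4]
    refine hvol.trans (le_of_eq ?_)
    field_simp
    ring
  have hM0 : 0 ≤ ∫ x, x ^ p ∂ν := integral_nonneg_of_ae (hν.mono fun x hx =>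
    Real.rpow_nonneg (hδ.le.trans hx.1) p)
  calc 4 * π * (m ^ p * ∫ x, x ^ p ∂ν) ≤ 4 * π * (exp (p * (m-1)) * exp (p + p^2/4)) := by gcongr
    _ = 4 * π * exp (m * p + p^2/4) := by rw [← Real.exp_add]; congr 2; ring
    _ ≤ 4 * π * exp (V*p/(8*π^2) + p^2/4) := by
      have : m * p ≤ V*p/(8*π^2) := by
        calc m * p ≤ V / (8*π^2) * p := by gcongr
          _ = _ := by ring
      gcongr
end

section
/- Let f be a smooth positive function on the round S² satisfying Δf ≤ f and ∫_{S²} f dvol ≤ V/(2π). Then for every p ∈ [1, 2), the quantity ‖f‖_{W^{1,p}(S²)} is bounded by a constant depending only on p and V; explicitly, ‖∇f‖_{L^p(S²)} ≤ ‖∇ ln f‖_{L²(S²)} · ‖f‖_{L^{2p/(2−p)}(S²)}, and both factors are bounded in terms of V and p. -/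
open Real MeasureTheory intervalIntegral

/-- The squared norm of the gradient on the round `S²` in geodesic polar coordinates. -/
noncomputable def gradSq (u : ℝ → ℝ → ℝ) (r θ : ℝ) : ℝ :=
  (deriv (fun s => u s θ) r)^2 + (1 / Real.sin r ^ 2) * (deriv (u r) θ)^2

/-- The `L^q(S²)` norm of a function. -/
noncomputable def sphereLpNorm (G : ℝ → ℝ → ℝ) (q : ℝ) : ℝ :=
  (sphereIntegral (fun r θ => |G r θ| ^ q)) ^ (1/q)


noncomputable def D1 (F : ℝ → ℝ → ℝ) (r θ : ℝ) : ℝ := deriv (fun s => F s θ) r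
noncomputable def D2 (F : ℝ → ℝ → ℝ) (r θ : ℝ) : ℝ := deriv (F r) θ

structure Nice (F : ℝ → ℝ → ℝ) : Prop where
  smooth : ContDiff ℝ (⊤ : ℕ∞) (Function.uncurry F)
  per : ∀ r, Function.Periodic (F r) (2*π)
  pole0 : ∀ θ₁ θ₂, F 0 θ₁ = F 0 θ₂
  polepi : ∀ θ₁ θ₂, F π θ₁ = F π θ₂

abbrev Smooth2 (F : ℝ → ℝ → ℝ) : Prop := ContDiff ℝ (⊤ : ℕ∞) (Function.uncurry F)

lemma hasD1' {F : ℝ → ℝ → ℝ} (h : Smooth2 F) (r θ : ℝ) :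
    HasDerivAt (fun s => F s θ) (fderiv ℝ (Function.uncurry F) (r, θ) (1, 0)) r := by
  have h1 : HasFDerivAt (Function.uncurry F) (fderiv ℝ (Function.uncurry F) (r, θ)) (r, θ) :=
    ((h.differentiable (by simp)) (r, θ)).hasFDerivAt
  have h2 : HasDerivAt (fun s : ℝ => (s, θ)) ((1 : ℝ), (0 : ℝ)) r :=
    (hasDerivAt_id r).prodMk (hasDerivAt_const r θ)
  exact h1.comp_hasDerivAt r h2

lemma hasD2' {F : ℝ → ℝ → ℝ} (h : Smooth2 F) (r θ : ℝ) :
    HasDerivAt (F r) (fderiv ℝ (Function.uncurry F) (r, θ) (0, 1)) θ := by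
  have h1 : HasFDerivAt (Function.uncurry F) (fderiv ℝ (Function.uncurry F) (r, θ)) (r, θ) :=
    ((h.differentiable (by simp)) (r, θ)).hasFDerivAt
  have h2 : HasDerivAt (fun s : ℝ => (r, s)) ((0 : ℝ), (1 : ℝ)) θ :=
    (hasDerivAt_const θ r).prodMk (hasDerivAt_id θ)
  exact h1.comp_hasDerivAt θ h2

lemma hasD1 {F : ℝ → ℝ → ℝ} (h : Smooth2 F) (r θ : ℝ) :
    HasDerivAt (fun s => F s θ) (D1 F r θ) r :=
  (hasD1' h r θ).differentiableAt.hasDerivAt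

lemma hasD2 {F : ℝ → ℝ → ℝ} (h : Smooth2 F) (r θ : ℝ) :
    HasDerivAt (F r) (D2 F r θ) θ :=
  (hasD2' h r θ).differentiableAt.hasDerivAt

lemma smD1 {F : ℝ → ℝ → ℝ} (h : Smooth2 F) : Smooth2 (D1 F) := by
  have : Function.uncurry (D1 F) = fun z => fderiv ℝ (Function.uncurry F) z (1, 0) := by
    funext ⟨r, θ⟩
    exact (hasD1' h r θ).deriv
  unfold Smooth2
  rw [this]
  exact (h.fderiv_right (m := (⊤ : ℕ∞)) (by simp)).clm_apply contDiff_const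

lemma smD2 {F : ℝ → ℝ → ℝ} (h : Smooth2 F) : Smooth2 (D2 F) := by
  have : Function.uncurry (D2 F) = fun z => fderiv ℝ (Function.uncurry F) z (0, 1) := by
    funext ⟨r, θ⟩
    exact (hasD2' h r θ).deriv
  unfold Smooth2
  rw [this]
  exact (h.fderiv_right (m := (⊤ : ℕ∞)) (by simp)).clm_apply contDiff_const

lemma Smooth2.cont {F : ℝ → ℝ → ℝ} (h : Smooth2 F) : Continuous (fun z : ℝ × ℝ => F z.1 z.2) :=
  ContDiff.continuous h

lemma D2_zero {F : ℝ → ℝ → ℝ} {r : ℝ} (h : ∀ θ₁ θ₂, F r θ₁ = F r θ₂) (θ : ℝ) : D2 F r θ = 0 := by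
  unfold D2
  have : F r = fun _ => F r 0 := by funext s; exact h s 0
  rw [this]; simp

lemma D2_per {F : ℝ → ℝ → ℝ} {r : ℝ} (h : Function.Periodic (F r) (2*π)) :
    Function.Periodic (D2 F r) (2*π) := by
  intro θ
  unfold D2
  have : F r = fun s => F r (s + 2*π) := by funext s; exact (h s).symm
  conv_rhs => rw [this]
  rw [deriv_comp_add_const]

/-- The coordinate domain. -/
def Om : Set (ℝ × ℝ) := Set.Ioo 0 π ×ˢ Set.Ioo 0 (2*π)

lemma Om_meas : MeasurableSet Om := measurableSet_Ioo.prod measurableSet_Ioo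

lemma Om_sin {z : ℝ × ℝ} (h : z ∈ Om) : 0 < sin z.1 := sin_pos_of_mem_Ioo h.1

lemma Om_sub : Om ⊆ Set.Icc 0 π ×ˢ Set.Icc 0 (2*π) :=
  Set.prod_mono Set.Ioo_subset_Icc_self Set.Ioo_subset_Icc_self

lemma bdd_of_cont {g : ℝ × ℝ → ℝ} (h : Continuous g) :
    ∃ C, 0 ≤ C ∧ ∀ z ∈ Set.Icc 0 π ×ˢ Set.Icc 0 (2*π), |g z| ≤ C := by
  obtain ⟨C, hC⟩ := (isCompact_Icc.prod isCompact_Icc :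
    IsCompact (Set.Icc (0:ℝ) π ×ˢ Set.Icc (0:ℝ) (2*π))).exists_bound_of_continuousOn h.continuousOn
  exact ⟨max C 0, le_max_right _ _, fun z hz => (hC z hz).trans (le_max_left _ _)⟩

lemma sin_bound {G : ℝ → ℝ → ℝ} (h : Smooth2 G) (h0 : ∀ θ, G 0 θ = 0) (hpi : ∀ θ, G π θ = 0) :
    ∃ C, 0 ≤ C ∧ ∀ z ∈ Om, |G z.1 z.2| ≤ C * sin z.1 := by
  obtain ⟨C, hC0, hC⟩ := bdd_of_cont (smD1 h).cont
  refine ⟨C * (π/2), by positivity, ?_⟩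
  rintro ⟨r, θ⟩ ⟨hr, hθ⟩
  simp only at hr hθ ⊢
  have key : ∀ a ∈ Set.Icc 0 π, ∀ b ∈ Set.Icc 0 π, |G b θ - G a θ| ≤ C * |b - a| := by
    intro a ha b hb
    exact (convex_Icc (0:ℝ) π).norm_image_sub_le_of_norm_hasDerivWithin_le
      (f := fun s => G s θ) (f' := fun s => D1 G s θ)
      (fun x _ => (hasD1 h x θ).hasDerivWithinAt)
      (fun x hx => hC (x, θ) ⟨hx, Set.Ioo_subset_Icc_self hθ⟩) ha hb
  have hp := pi_pos
  have hr' := Set.Ioo_subset_Icc_self hr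
  have k0 := key 0 ⟨le_rfl, hp.le⟩ r hr'
  have k1 := key π ⟨hp.le, le_rfl⟩ r hr'
  rw [h0, sub_zero, sub_zero, abs_of_pos hr.1] at k0
  rw [hpi, sub_zero, abs_sub_comm, abs_of_pos (by linarith [hr.2] : 0 < π - r)] at k1
  rcases le_total r (π/2) with hh | hh
  · have := mul_le_sin hr.1.le hh
    have h2 : r ≤ π/2 * sin r := by
      rw [div_mul_eq_mul_div, div_le_iff₀ hp] at this
      linarith
    calc _ ≤ C * r := k0
      _ ≤ C * (π/2 * sin r) := by gcongr
      _ = _ := by ring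
  · have := mul_le_sin (x := π - r) (by linarith [hr.2]) (by linarith)
    rw [sin_pi_sub] at this
    have h2 : π - r ≤ π/2 * sin r := by
      rw [div_mul_eq_mul_div, div_le_iff₀ hp] at this
      linarith
    calc _ ≤ C * (π - r) := k1
      _ ≤ C * (π/2 * sin r) := by gcongr
      _ = _ := by ring

/-- Round area measure. -/
noncomputable def sg : Measure (ℝ × ℝ) :=
  (volume.restrict Om).withDensity (fun z => ENNReal.ofReal (sin z.1))

def Adm (G : ℝ → ℝ → ℝ) : Prop :=
  ContinuousOn (fun z : ℝ × ℝ => G z.1 z.2) Om ∧ ∃ C, ∀ z ∈ Om, |G z.1 z.2 * sin z.1| ≤ C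

lemma Om_fin : volume Om < ⊤ := by
  rw [Om, Measure.volume_eq_prod, Measure.prod_prod]
  simp [ENNReal.mul_lt_top]

lemma intOn_bdd {g : ℝ × ℝ → ℝ} (h : ContinuousOn g Om) (hb : ∃ C, ∀ z ∈ Om, |g z| ≤ C) :
    IntegrableOn g Om := by
  obtain ⟨C, hC⟩ := hb
  exact IntegrableOn.of_bound Om_fin
    (h.aestronglyMeasurable Om_meas) C ((ae_restrict_iff' Om_meas).2 (ae_of_all _ hC))

lemma sg_int_eq (g : ℝ × ℝ → ℝ) : ∫ z, g z ∂sg = ∫ z in Om, g z * sin z.1 := by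
  unfold sg
  rw [integral_withDensity_eq_integral_toReal_smul (by fun_prop) (by simp)]
  refine setIntegral_congr_fun Om_meas fun z hz => ?_
  simp only [smul_eq_mul]
  rw [ENNReal.toReal_ofReal (Om_sin hz).le, mul_comm]

lemma sg_integrable_iff (g : ℝ × ℝ → ℝ) :
    Integrable g sg ↔ IntegrableOn (fun z => g z * sin z.1) Om := by
  unfold sg
  rw [integrable_withDensity_iff_integrable_smul' (by fun_prop) (by simp)]
  refine integrableOn_congr_fun (fun z hz => ?_) Om_meas
  simp only [smul_eq_mul]
  rw [ENNReal.toReal_ofReal (Om_sin hz).le, mul_comm]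

lemma sg_ae {p : ℝ × ℝ → Prop} (h : ∀ z ∈ Om, p z) : ∀ᵐ z ∂sg, p z := by
  have : sg ≪ volume.restrict Om := withDensity_absolutelyContinuous _ _
  exact this.ae_le ((ae_restrict_iff' Om_meas).2 (ae_of_all _ h))

lemma Adm.intOn {G : ℝ → ℝ → ℝ} (h : Adm G) :
    IntegrableOn (fun z : ℝ × ℝ => G z.1 z.2 * sin z.1) Om :=
  intOn_bdd (h.1.mul (by fun_prop)) h.2

lemma Adm.int {G : ℝ → ℝ → ℝ} (h : Adm G) : Integrable (fun z : ℝ × ℝ => G z.1 z.2) sg :=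
  (sg_integrable_iff _).2 h.intOn

lemma Om_fubini {g : ℝ × ℝ → ℝ} (h : IntegrableOn g Om) :
    ∫ z in Om, g z = ∫ r in (0:ℝ)..π, ∫ θ in (0:ℝ)..(2*π), g (r, θ) := by
  have hp := pi_pos
  rw [Om, Measure.volume_eq_prod, setIntegral_prod _ h,
    intervalIntegral.integral_of_le hp.le, integral_Ioc_eq_integral_Ioo]
  congr 1; funext r
  rw [intervalIntegral.integral_of_le (by linarith), integral_Ioc_eq_integral_Ioo]

lemma Om_fubini' {g : ℝ × ℝ → ℝ} (h : IntegrableOn g Om) :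
    ∫ z in Om, g z = ∫ θ in (0:ℝ)..(2*π), ∫ r in (0:ℝ)..π, g (r, θ) := by
  have hp := pi_pos
  have h' : Integrable g ((volume.restrict (Set.Ioo 0 π)).prod (volume.restrict (Set.Ioo 0 (2*π)))) := by
    rw [Measure.prod_restrict]; exact h
  rw [Om, Measure.volume_eq_prod, ← Measure.prod_restrict, integral_prod_symm _ h',
    intervalIntegral.integral_of_le (by linarith), integral_Ioc_eq_integral_Ioo]
  congr 1; funext r
  rw [intervalIntegral.integral_of_le (by linarith), integral_Ioc_eq_integral_Ioo]

lemma Adm.sph {G : ℝ → ℝ → ℝ} (h : Adm G) : sphereIntegral G = ∫ z, G z.1 z.2 ∂sg := by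
  rw [sg_int_eq, Om_fubini h.intOn]; rfl

lemma adm_bdd {G : ℝ → ℝ → ℝ} (h : ContinuousOn (fun z : ℝ × ℝ => G z.1 z.2) Om)
    (hb : ∃ C, ∀ z ∈ Om, |G z.1 z.2| ≤ C) : Adm G := by
  obtain ⟨C, hC⟩ := hb
  refine ⟨h, C, fun z hz => ?_⟩
  rw [abs_mul]
  calc _ ≤ |G z.1 z.2| * 1 := by gcongr; exact abs_sin_le_one _
    _ ≤ C := by rw [mul_one]; exact hC z hz

lemma adm_cont {G : ℝ → ℝ → ℝ} (h : Continuous (fun z : ℝ × ℝ => G z.1 z.2)) : Adm G := by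
  obtain ⟨C, _, hC⟩ := bdd_of_cont h
  exact adm_bdd h.continuousOn ⟨C, fun z hz => hC z (Om_sub hz)⟩

lemma sg_one : ∫ _z, (1:ℝ) ∂sg = 4*π := by
  have := (adm_cont (G := fun _ _ => 1) continuous_const).sph
  rw [← this, sphereIntegral]
  simp [intervalIntegral.integral_const]
  ring

instance sg_finite : IsFiniteMeasure sg := by
  have := (adm_cont (G := fun _ _ => 1) continuous_const).int
  rw [integrable_const_iff] at this
  simpa using this

lemma sphLap_eq (F : ℝ → ℝ → ℝ) (r θ : ℝ) : sphLap F r θ =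
    D1 (D1 F) r θ + (cos r / sin r) * D1 F r θ + (1 / sin r ^ 2) * D2 (D2 F) r θ := rfl

noncomputable def gradIn (W F : ℝ → ℝ → ℝ) (r θ : ℝ) : ℝ :=
  D1 W r θ * D1 F r θ + (1 / sin r ^ 2) * (D2 W r θ * D2 F r θ)

lemma Nice.D2bound {F : ℝ → ℝ → ℝ} (h : Nice F) :
    ∃ C, 0 ≤ C ∧ ∀ z ∈ Om, |D2 F z.1 z.2| ≤ C * sin z.1 :=
  sin_bound (smD2 h.smooth) (D2_zero h.pole0) (D2_zero h.polepi)

lemma Nice.D22bound {F : ℝ → ℝ → ℝ} (h : Nice F) :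
    ∃ C, 0 ≤ C ∧ ∀ z ∈ Om, |D2 (D2 F) z.1 z.2| ≤ C * sin z.1 :=
  sin_bound (smD2 (smD2 h.smooth))
    (D2_zero fun a b => by rw [D2_zero h.pole0, D2_zero h.pole0])
    (D2_zero fun a b => by rw [D2_zero h.polepi, D2_zero h.polepi])

lemma gradIn_adm' {F W : ℝ → ℝ → ℝ} (h : Nice F) (hW : Nice W) :
    ContinuousOn (fun z : ℝ × ℝ => gradIn W F z.1 z.2) Om ∧
      ∃ C, ∀ z ∈ Om, |gradIn W F z.1 z.2| ≤ C := by
  have c1 := (smD1 h.smooth).cont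
  have c2 := (smD2 h.smooth).cont
  have c3 := (smD1 hW.smooth).cont
  have c4 := (smD2 hW.smooth).cont
  constructor
  · unfold gradIn
    have : ∀ z ∈ Om, sin z.1 ^ 2 ≠ 0 := fun z hz => (pow_pos (Om_sin hz) 2).ne'
    exact (c3.mul c1).continuousOn.add
      ((ContinuousOn.div (by fun_prop) (by fun_prop) this).mul (c4.mul c2).continuousOn)
  · obtain ⟨C1, hC1, h1⟩ := bdd_of_cont c1
    obtain ⟨C3, hC3, h3⟩ := bdd_of_cont c3
    obtain ⟨C2, hC2, h2⟩ := h.D2bound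
    obtain ⟨C4, hC4, h4⟩ := hW.D2bound
    refine ⟨C3 * C1 + C4 * C2, fun z hz => ?_⟩
    have hs := Om_sin hz
    have a1 := h1 z (Om_sub hz)
    have a3 := h3 z (Om_sub hz)
    have a2 := h2 z hz
    have a4 := h4 z hz
    unfold gradIn
    refine (abs_add_le _ _).trans (add_le_add ?_ ?_)
    · rw [abs_mul]; gcongr
    · rw [abs_mul, abs_mul, abs_of_pos (by positivity), one_div, inv_mul_le_iff₀ (by positivity)]
      calc _ ≤ (C4 * sin z.1) * (C2 * sin z.1) := by gcongr
        _ = _ := by ring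

lemma gradIn_adm {F W : ℝ → ℝ → ℝ} (h : Nice F) (hW : Nice W) : Adm (gradIn W F) :=
  adm_bdd (gradIn_adm' h hW).1 (gradIn_adm' h hW).2

lemma lap_adm {F : ℝ → ℝ → ℝ} (h : Nice F) : Adm (sphLap F) := by
  have c1 := (smD1 h.smooth).cont
  have c11 := (smD1 (smD1 h.smooth)).cont
  have c22 := (smD2 (smD2 h.smooth)).cont
  constructor
  · have h1 : ∀ z ∈ Om, sin z.1 ≠ 0 := fun z hz => (Om_sin hz).ne'
    have h2 : ∀ z ∈ Om, sin z.1 ^ 2 ≠ 0 := fun z hz => (pow_pos (Om_sin hz) 2).ne'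
    simp only [sphLap_eq]
    exact (c11.continuousOn.add ((ContinuousOn.div (by fun_prop) (by fun_prop) h1).mul
      c1.continuousOn)).add ((ContinuousOn.div (by fun_prop) (by fun_prop) h2).mul c22.continuousOn)
  · obtain ⟨C1, hC1, h1⟩ := bdd_of_cont c1
    obtain ⟨C3, hC3, h3⟩ := bdd_of_cont c11
    obtain ⟨C2, hC2, h2⟩ := h.D22bound
    refine ⟨C3 * 1 + 1 * C1 + C2, fun z hz => ?_⟩
    have hs := Om_sin hz
    have a1 := h1 z (Om_sub hz)
    have a3 := h3 z (Om_sub hz)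
    have a2 := h2 z hz
    have : sphLap F z.1 z.2 * sin z.1 = D1 (D1 F) z.1 z.2 * sin z.1 + cos z.1 * D1 F z.1 z.2
        + (1 / sin z.1) * D2 (D2 F) z.1 z.2 := by
      rw [sphLap_eq]; field_simp
    rw [this]
    refine (abs_add_le _ _).trans (add_le_add ((abs_add_le _ _).trans (add_le_add ?_ ?_)) ?_)
    · rw [abs_mul]; gcongr; exact abs_sin_le_one _
    · rw [abs_mul]; gcongr; exact abs_cos_le_one _
    · rw [abs_mul, abs_of_pos (by positivity), one_div, inv_mul_le_iff₀ hs]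
      linarith

lemma Adm.mul_cont {F W : ℝ → ℝ → ℝ} (h : Adm F) (hW : Continuous (fun z : ℝ × ℝ => W z.1 z.2)) :
    Adm (fun r θ => W r θ * F r θ) := by
  obtain ⟨C, hC⟩ := h.2
  obtain ⟨D, hD0, hD⟩ := bdd_of_cont hW
  refine ⟨hW.continuousOn.mul h.1, D * C, fun z hz => ?_⟩
  rw [mul_assoc, abs_mul]
  exact mul_le_mul (hD z (Om_sub hz)) (hC z hz) (abs_nonneg _) hD0

lemma green {F W : ℝ → ℝ → ℝ} (h : Nice F) (hW : Nice W) :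
    ∫ z, W z.1 z.2 * sphLap F z.1 z.2 ∂sg = - ∫ z, gradIn W F z.1 z.2 ∂sg := by
  have c0 := Smooth2.cont hW.smooth
  have i1 := ((lap_adm h).mul_cont c0).int
  have i2 := (gradIn_adm h hW).int
  have key : ∫ z, (W z.1 z.2 * sphLap F z.1 z.2 + gradIn W F z.1 z.2) ∂sg = 0 := by
    rw [sg_int_eq]
    have c1 := (smD1 h.smooth).cont
    have c2 := (smD2 h.smooth).cont
    have c3 := (smD1 hW.smooth).cont
    have c4 := (smD2 hW.smooth).cont
    have c11 := (smD1 (smD1 h.smooth)).cont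
    have c22 := (smD2 (smD2 h.smooth)).cont
    set A : ℝ × ℝ → ℝ := fun z => (D1 W z.1 z.2 * D1 F z.1 z.2 + W z.1 z.2 * D1 (D1 F) z.1 z.2) * sin z.1
      + (W z.1 z.2 * D1 F z.1 z.2) * cos z.1 with hA
    have cA : Continuous A := by
      exact (((c3.mul c1).add (c0.mul c11)).mul (by fun_prop)).add ((c0.mul c1).mul (by fun_prop))
    have iA : IntegrableOn A Om := by
      obtain ⟨C, _, hC⟩ := bdd_of_cont cA
      exact intOn_bdd cA.continuousOn ⟨C, fun z hz => hC z (Om_sub hz)⟩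
    set T : ℝ × ℝ → ℝ := fun z =>
      (W z.1 z.2 * sphLap F z.1 z.2 + gradIn W F z.1 z.2) * sin z.1 with hT
    have iT : IntegrableOn T Om := (sg_integrable_iff _).1 (i1.add i2)
    set B : ℝ × ℝ → ℝ := fun z => 
      (D2 W z.1 z.2 * D2 F z.1 z.2 + W z.1 z.2 * D2 (D2 F) z.1 z.2) * (1 / sin z.1) with hB
    have eT : Set.EqOn T (A + B) Om := by
      intro z hz
      have hs := (Om_sin hz).ne'
      simp only [hT, hA, hB, Pi.add_apply, sphLap_eq, gradIn]
      field_simp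
      ring
    have iB : IntegrableOn B Om := by
      have : IntegrableOn (A + B) Om := (integrableOn_congr_fun eT Om_meas).1 iT
      have := this.sub iA
      simpa using this
    rw [setIntegral_congr_fun Om_meas eT]
    simp only [Pi.add_apply]
    rw [integral_add iA iB, Om_fubini' iA, Om_fubini iB]
    have zA : ∀ θ, ∫ r in (0:ℝ)..π, A (r, θ) = 0 := by
      intro θ
      have hd : ∀ r ∈ Set.uIcc 0 π, HasDerivAt (fun r => (W r θ * D1 F r θ) * sin r) (A (r, θ)) r :=
        fun r _ => ((hasD1 hW.smooth r θ).mul (hasD1 (smD1 h.smooth) r θ)).mul (hasDerivAt_sin r)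
      rw [intervalIntegral.integral_eq_sub_of_hasDerivAt hd
        ((cA.comp (by fun_prop : Continuous fun r : ℝ => (r, θ))).intervalIntegrable _ _)]
      simp
    have zB : ∀ r, ∫ θ in (0:ℝ)..(2*π), B (r, θ) = 0 := by
      intro r
      simp only [hB]
      rw [intervalIntegral.integral_mul_const]
      have hd : ∀ θ ∈ Set.uIcc 0 (2*π), HasDerivAt (fun θ => (W r θ * D2 F r θ))
          (D2 W r θ * D2 F r θ + W r θ * D2 (D2 F) r θ) θ :=
        fun θ _ => ((hasD2 hW.smooth r θ).mul (hasD2 (smD2 h.smooth) r θ))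
      rw [intervalIntegral.integral_eq_sub_of_hasDerivAt hd
        ((((c4.mul c2).add (c0.mul c22)).comp
          (by fun_prop : Continuous fun θ : ℝ => (r, θ))).intervalIntegrable _ _)]
      have e1 := hW.per r 0
      have e2 := D2_per (h.per r) 0
      rw [zero_add] at e1 e2
      rw [e1, e2]; simp
    simp [zA, zB]
  rw [integral_add i1 i2] at key
  linarith

lemma gradIn_comm (W F : ℝ → ℝ → ℝ) (r θ : ℝ) : gradIn W F r θ = gradIn F W r θ := by
  unfold gradIn; ring

lemma green_symm {F W : ℝ → ℝ → ℝ} (h : Nice F) (hW : Nice W) :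
    ∫ z, W z.1 z.2 * sphLap F z.1 z.2 ∂sg = ∫ z, F z.1 z.2 * sphLap W z.1 z.2 ∂sg := by
  rw [green h hW, green hW h]
  simp only [gradIn_comm]

lemma green_one {F : ℝ → ℝ → ℝ} (h : Nice F) : ∫ z, sphLap F z.1 z.2 ∂sg = 0 := by
  have h1 : Nice (fun _ _ => (1:ℝ)) := ⟨contDiff_const, fun _ _ => rfl, fun _ _ => rfl, fun _ _ => rfl⟩
  have := green h h1
  simpa [gradIn, D1, D2] using this

lemma gradSq_eq (u : ℝ → ℝ → ℝ) (r θ : ℝ) : gradSq u r θ = gradIn u u r θ := by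
  unfold gradSq gradIn D1 D2; ring

lemma Nice.log {F : ℝ → ℝ → ℝ} (h : Nice F) (hpos : ∀ r θ, 0 < F r θ) :
    Nice (fun r θ => Real.log (F r θ)) := by
  refine ⟨?_, fun r θ => by simp only [h.per r θ], fun a b => by simp only [h.pole0 a b],
    fun a b => by simp only [h.polepi a b]⟩
  have := ContDiff.log h.smooth (fun z => (hpos z.1 z.2).ne')
  exact this

lemma Nice.inv {F : ℝ → ℝ → ℝ} (h : Nice F) (hpos : ∀ r θ, 0 < F r θ) :
    Nice (fun r θ => (F r θ)⁻¹) := by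
  refine ⟨?_, fun r θ => by simp only [h.per r θ], fun a b => by simp only [h.pole0 a b],
    fun a b => by simp only [h.polepi a b]⟩
  have := ContDiff.inv h.smooth (fun z => (hpos z.1 z.2).ne')
  exact this

lemma gradSq_log {F : ℝ → ℝ → ℝ} (h : Nice F) (hpos : ∀ r θ, 0 < F r θ) (r θ : ℝ) :
    gradSq (fun r θ => Real.log (F r θ)) r θ = gradSq F r θ / F r θ ^ 2 := by
  have h1 : deriv (fun s => Real.log (F s θ)) r = D1 F r θ / F r θ :=
    ((hasD1 h.smooth r θ).log (hpos r θ).ne').deriv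
  have h2 : deriv (fun s => Real.log (F r s)) θ = D2 F r θ / F r θ :=
    ((hasD2 h.smooth r θ).log (hpos r θ).ne').deriv
  have := (hpos r θ).ne'
  unfold gradSq
  rw [h1, h2]
  unfold D1 D2
  field_simp

lemma gradIn_inv {F : ℝ → ℝ → ℝ} (h : Nice F) (hpos : ∀ r θ, 0 < F r θ) (r θ : ℝ) :
    gradIn (fun r θ => (F r θ)⁻¹) F r θ = - gradSq (fun r θ => Real.log (F r θ)) r θ := by
  rw [gradSq_log h hpos]
  have h1 : D1 (fun r θ => (F r θ)⁻¹) r θ = - D1 F r θ / F r θ ^ 2 :=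
    ((hasD1 h.smooth r θ).fun_inv (hpos r θ).ne').deriv
  have h2 : D2 (fun r θ => (F r θ)⁻¹) r θ = - D2 F r θ / F r θ ^ 2 :=
    ((hasD2 h.smooth r θ).fun_inv (hpos r θ).ne').deriv
  have := (hpos r θ).ne'
  rw [gradSq_eq]
  unfold gradIn
  rw [h1, h2]
  field_simp
  ring

lemma gradSq_adm {F : ℝ → ℝ → ℝ} (h : Nice F) : Adm (gradSq F) := by
  have : gradSq F = gradIn F F := by funext r θ; exact gradSq_eq F r θ
  rw [this]; exact gradIn_adm h h

lemma gradlog_bound {F : ℝ → ℝ → ℝ} (h : Nice F) (hpos : ∀ r θ, 0 < F r θ)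
    (hlap : ∀ r ∈ Set.Ioo (0:ℝ) π, ∀ θ, sphLap F r θ ≤ F r θ) :
    sphereIntegral (gradSq (fun r θ => Real.log (F r θ))) ≤ 4*π := by
  rw [(gradSq_adm (h.log hpos)).sph]
  have g := green h (h.inv hpos)
  simp only [gradIn_inv h hpos] at g
  rw [MeasureTheory.integral_neg, neg_neg] at g
  rw [← g, ← sg_one]
  refine integral_mono_ae ((lap_adm h).mul_cont (Smooth2.cont (h.inv hpos).smooth)).int
    (integrable_const _) (sg_ae fun z hz => ?_)
  have := hlap z.1 hz.1 z.2
  have hp := hpos z.1 z.2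
  simp only
  rw [inv_mul_le_iff₀ hp, mul_one]; exact this

lemma gradSq_nonneg (F : ℝ → ℝ → ℝ) (r θ : ℝ) : 0 ≤ gradSq F r θ := by
  unfold gradSq; positivity

lemma memLp_sg {g : ℝ × ℝ → ℝ} (h : ContinuousOn g Om) (hb : ∃ C, ∀ z ∈ Om, |g z| ≤ C)
    (p : ENNReal) : MemLp g p sg := by
  obtain ⟨C, hC⟩ := hb
  refine MemLp.of_bound ?_ C (sg_ae hC)
  exact (h.aestronglyMeasurable Om_meas).mono_ac (withDensity_absolutelyContinuous _ _)

lemma holder_part {F : ℝ → ℝ → ℝ} (h : Nice F) (hpos : ∀ r θ, 0 < F r θ) {p : ℝ}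
    (hp1 : 1 ≤ p) (hp2 : p < 2) :
    (sphereIntegral (fun r θ => Real.sqrt (gradSq F r θ) ^ p)) ^ (1/p)
          ≤ Real.sqrt (sphereIntegral (gradSq (fun r θ => Real.log (F r θ))))
            * sphereLpNorm F (2*p/(2-p)) := by
  have hp0 : 0 < p := by linarith
  have h2p : 0 < 2 - p := by linarith
  have cF := Smooth2.cont h.smooth
  set L := gradSq (fun r θ => Real.log (F r θ)) with hL
  have hLn : ∀ r θ, 0 ≤ L r θ := gradSq_nonneg _
  have aL : ContinuousOn (fun z : ℝ × ℝ => L z.1 z.2) Om ∧ ∃ C, ∀ z ∈ Om, |L z.1 z.2| ≤ C := by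
    have := gradIn_adm' (h.log hpos) (h.log hpos)
    simpa only [hL, gradSq_eq] using this
  set u : ℝ × ℝ → ℝ := fun z => Real.sqrt (L z.1 z.2) ^ p with hu
  set v : ℝ × ℝ → ℝ := fun z => F z.1 z.2 ^ p with hv
  have un : ∀ z, 0 ≤ u z := fun z => by positivity
  have vn : ∀ z, 0 ≤ v z := fun z => rpow_nonneg (hpos _ _).le _
  have eL : ∀ r θ, Real.sqrt (gradSq F r θ) ^ p = Real.sqrt (L r θ) ^ p * F r θ ^ p := by
    intro r θ
    have hp := hpos r θ
    rw [← mul_rpow (sqrt_nonneg _) hp.le]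
    congr 1
    rw [hL, gradSq_log h hpos, sqrt_div (gradSq_nonneg _ _ _), sqrt_sq hp.le]
    field_simp
  have cu : ContinuousOn u Om := aL.1.sqrt.rpow_const (fun _ _ => Or.inr hp0.le)
  have bu : ∃ C, ∀ z ∈ Om, |u z| ≤ C := by
    obtain ⟨C, hC⟩ := aL.2
    refine ⟨Real.sqrt C ^ p, fun z hz => ?_⟩
    rw [abs_of_nonneg (un z)]
    exact rpow_le_rpow (sqrt_nonneg _) (sqrt_le_sqrt ((le_abs_self _).trans (hC z hz))) hp0.le
  have cv : Continuous v := cF.rpow_const (fun _ => Or.inr hp0.le)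
  have bv : ∃ C, ∀ z ∈ Om, |v z| ≤ C := by
    obtain ⟨C, _, hC⟩ := bdd_of_cont cv
    exact ⟨C, fun z hz => hC z (Om_sub hz)⟩
  have aLHS : Adm (fun r θ => Real.sqrt (gradSq F r θ) ^ p) := by
    simp only [eL]
    refine adm_bdd (cu.mul cv.continuousOn) ?_
    obtain ⟨C, hC⟩ := bu
    obtain ⟨D, hD⟩ := bv
    refine ⟨C * D, fun z hz => ?_⟩
    have h1 := hC z hz
    have h2 := hD z hz
    have e : Real.sqrt (L z.1 z.2) ^ p * F z.1 z.2 ^ p = u z * v z := rfl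
    rw [e, abs_mul]
    exact mul_le_mul h1 h2 (abs_nonneg _) ((abs_nonneg _).trans h1)
  have aq : Adm (fun r θ => |F r θ| ^ (2*p/(2-p))) :=
    adm_cont (cF.abs.rpow_const (fun _ => Or.inr (by positivity)))
  have hconj : (2/p).HolderConjugate (2/(2-p)) := by
    rw [Real.holderConjugate_iff]
    refine ⟨by rw [lt_div_iff₀ hp0]; linarith, ?_⟩
    field_simp; ring
  have H := integral_mul_le_Lp_mul_Lq_of_nonneg (μ := sg) hconj (f := u) (g := v)
    (ae_of_all _ un) (ae_of_all _ vn) (memLp_sg cu bu _) (memLp_sg cv.continuousOn bv _)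
  have e1 : ∀ z, u z ^ (2/p) = L z.1 z.2 := by
    intro z
    simp only [hu]
    rw [← rpow_mul (sqrt_nonneg _), mul_div_cancel₀ _ hp0.ne', rpow_two, sq_sqrt (hLn _ _)]
  have e2 : ∀ z, v z ^ (2/(2-p)) = |F z.1 z.2| ^ (2*p/(2-p)) := by
    intro z
    simp only [hv]
    rw [← rpow_mul (hpos _ _).le, abs_of_pos (hpos _ _)]
    congr 1; ring
  simp only [e1, e2] at H
  unfold sphereLpNorm
  rw [aLHS.sph, aq.sph, (gradSq_adm (h.log hpos)).sph]
  simp only [eL]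
  have IL : 0 ≤ ∫ z, L z.1 z.2 ∂sg := integral_nonneg fun z => hLn _ _
  have Iq : 0 ≤ ∫ z, |F z.1 z.2| ^ (2*p/(2-p)) ∂sg := integral_nonneg fun z => by positivity
  calc (∫ z, u z * v z ∂sg) ^ (1/p) ≤ _ :=
        rpow_le_rpow (integral_nonneg fun z => mul_nonneg (un z) (vn z)) H (by positivity)
    _ = _ := by
        rw [mul_rpow (rpow_nonneg IL _) (rpow_nonneg Iq _), ← rpow_mul IL, ← rpow_mul Iq,
          sqrt_eq_rpow]
        congr 2 <;> field_simp

/-- inner product of the points with coordinates y and (r,θ) -/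
noncomputable def TT (y : ℝ × ℝ) (r θ : ℝ) : ℝ :=
  cos r * cos y.1 + sin r * sin y.1 * cos (θ - y.2)

lemma TT_one_sub (y : ℝ × ℝ) (r θ : ℝ) :
    1 - TT y r θ = (1 - cos (r - y.1)) + sin r * sin y.1 * (1 - cos (θ - y.2)) := by
  unfold TT; rw [cos_sub r]; ring

lemma TT_symm (y z : ℝ × ℝ) : TT y z.1 z.2 = TT z y.1 y.2 := by
  unfold TT
  rw [← cos_neg (z.2 - y.2), neg_sub]; ring

lemma TT_abs (y : ℝ × ℝ) (r θ : ℝ) : |TT y r θ| ≤ 1 := by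
  have h1 : cos (θ - y.2) ≤ 1 := cos_le_one _
  have h2 : -1 ≤ cos (θ - y.2) := neg_one_le_cos _
  have h3 : |cos (θ - y.2)| ≤ 1 := abs_cos_le_one _
  rw [← sq_le_one_iff_abs_le_one]
  unfold TT
  have a := sin_sq_add_cos_sq r
  have b := sin_sq_add_cos_sq y.1
  have c := sin_sq_add_cos_sq (θ - y.2)
  set C := cos (θ - y.2)
  have : (cos r * cos y.1 + sin r * sin y.1 * C)^2 ≤
      (cos r ^2 + sin r ^2) * (cos y.1 ^2 + sin y.1 ^ 2 * C^2) := by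
    nlinarith [sq_nonneg (cos r * sin y.1 * C - sin r * cos y.1)]
  have c2 : C^2 ≤ 1 := by nlinarith [sq_nonneg (sin (θ - y.2))]
  nlinarith [mul_le_mul_of_nonneg_left c2 (sq_nonneg (sin y.1))]

lemma TT_le (y : ℝ × ℝ) (r θ : ℝ) : TT y r θ ≤ 1 := (abs_le.1 (TT_abs y r θ)).2
lemma TT_ge (y : ℝ × ℝ) (r θ : ℝ) : -1 ≤ TT y r θ := (abs_le.1 (TT_abs y r θ)).1

lemma TT_hasr (y : ℝ × ℝ) (r θ : ℝ) : HasDerivAt (fun s => TT y s θ)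
    (-sin r * cos y.1 + cos r * sin y.1 * cos (θ - y.2)) r := by
  unfold TT
  exact ((hasDerivAt_cos r).mul_const _).add (((hasDerivAt_sin r).mul_const _).mul_const _)

lemma TT_hasrr (y : ℝ × ℝ) (r θ : ℝ) :
    HasDerivAt (fun r => -sin r * cos y.1 + cos r * sin y.1 * cos (θ - y.2)) (-TT y r θ) r := by
  have := ((hasDerivAt_sin r).neg.mul_const (cos y.1)).add
    (((hasDerivAt_cos r).mul_const (sin y.1)).mul_const (cos (θ - y.2)))
  refine this.congr_deriv ?_
  unfold TT; ring

lemma TT_hasθ (y : ℝ × ℝ) (r θ : ℝ) : HasDerivAt (TT y r)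
    (-(sin r * sin y.1 * sin (θ - y.2))) θ := by
  have := (((hasDerivAt_id θ).sub_const y.2).cos.const_mul (sin r * sin y.1)).const_add
    (cos r * cos y.1)
  refine this.congr_deriv ?_
  simp

lemma TT_hasθθ (y : ℝ × ℝ) (r θ : ℝ) : HasDerivAt (fun θ => -(sin r * sin y.1 * sin (θ - y.2)))
    (-(sin r * sin y.1 * cos (θ - y.2))) θ := by
  have := (((hasDerivAt_id θ).sub_const y.2).sin.const_mul (sin r * sin y.1)).neg
  refine this.congr_deriv ?_
  simp

lemma lap_comp (y : ℝ × ℝ) (g g1 g2 : ℝ → ℝ) (hg : ∀ t ≤ 1, HasDerivAt g (g1 t) t)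
    (hg1 : ∀ t ≤ 1, HasDerivAt g1 (g2 t) t) (r θ : ℝ) (hr : sin r ≠ 0) :
    sphLap (fun r θ => g (TT y r θ)) r θ =
      g2 (TT y r θ) * (1 - TT y r θ ^ 2) - 2 * TT y r θ * g1 (TT y r θ) := by
  have e1 : D1 (fun r θ => g (TT y r θ)) = fun r θ =>
      g1 (TT y r θ) * (-sin r * cos y.1 + cos r * sin y.1 * cos (θ - y.2)) := by
    funext r θ
    exact ((hg _ (TT_le y r θ)).comp r (TT_hasr y r θ)).deriv
  have e2 : D2 (fun r θ => g (TT y r θ)) = fun r θ =>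
      g1 (TT y r θ) * (-(sin r * sin y.1 * sin (θ - y.2))) := by
    funext r θ
    exact ((hg _ (TT_le y r θ)).comp θ (TT_hasθ y r θ)).deriv
  have e11 : D1 (fun r θ =>
      g1 (TT y r θ) * (-sin r * cos y.1 + cos r * sin y.1 * cos (θ - y.2))) r θ = _ :=
    (((hg1 _ (TT_le y r θ)).comp r (TT_hasr y r θ)).mul (TT_hasrr y r θ)).deriv
  have e22 : D2 (fun r θ =>
      g1 (TT y r θ) * (-(sin r * sin y.1 * sin (θ - y.2)))) r θ = _ :=
    (((hg1 _ (TT_le y r θ)).comp θ (TT_hasθ y r θ)).mul (TT_hasθθ y r θ)).deriv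
  rw [sphLap_eq, e1, e2, e11, e22]
  simp only [Function.comp]
  generalize g1 (TT y r θ) = G1
  generalize g2 (TT y r θ) = G2
  have a := sin_sq_add_cos_sq r
  have b := sin_sq_add_cos_sq y.1
  have c := sin_sq_add_cos_sq (θ - y.2)
  unfold TT
  generalize cos (θ - y.2) = ct at *
  generalize sin (θ - y.2) = st at *
  generalize cos y.1 = cy at *
  generalize sin y.1 = sy at *
  generalize cos r = cr at *
  generalize sin r = sr at *
  have hst : st^2 = 1 - ct^2 := by linarith
  have hsy : cy^2 = 1 - sy^2 := by linarith
  have hcr : cr^2 = 1 - sr^2 := by linarith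
  have k2 : (-sr*cy + cr*sy*ct)^2 + sy^2*st^2 = 1 - (cr*cy + sr*sy*ct)^2 := by
    rw [hst]
    linear_combination (sy^2*ct^2 + cy^2) * a + b
  have k1 : -(cr*cy+sr*sy*ct) + cr/sr*(-sr*cy+cr*sy*ct) - (1/sr^2) * (sr*sy*ct)
      = -2*(cr*cy+sr*sy*ct) := by
    field_simp
    linear_combination (sy*ct) * a
  have : G2 * ((-sr*cy + cr*sy*ct)^2 + sy^2*st^2) + G1 * (-(cr*cy+sr*sy*ct) + cr/sr*(-sr*cy+cr*sy*ct) - (1/sr^2) * (sr*sy*ct)) = G2 * (1 - (cr*cy + sr*sy*ct)^2) - 2*(cr*cy+sr*sy*ct)*G1 := by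
    rw [k1, k2]; ring
  rw [← this]
  field_simp
  ring

/-- regularised distance -/
noncomputable def ww (e : ℝ) (y : ℝ × ℝ) (r θ : ℝ) : ℝ := 1 + e - TT y r θ

lemma ww_ge (e : ℝ) (y : ℝ × ℝ) (r θ : ℝ) : e ≤ ww e y r θ := by
  have := TT_le y r θ; unfold ww; linarith
lemma ww_le (e : ℝ) (y : ℝ × ℝ) (r θ : ℝ) : ww e y r θ ≤ 2 + e := by
  have := TT_ge y r θ; unfold ww; linarith
lemma ww_symm (e : ℝ) (y z : ℝ × ℝ) : ww e y z.1 z.2 = ww e z y.1 y.2 := by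
  unfold ww; rw [TT_symm]

lemma nice_comp_ww {e : ℝ} (he : 0 < e) (y : ℝ × ℝ) {g : ℝ → ℝ}
    (hg : ∀ t, 0 < t → ContDiffAt ℝ (⊤ : ℕ∞) g t) : Nice (fun r θ => g (ww e y r θ)) := by
  refine ⟨?_, fun r θ => ?_, fun a b => ?_, fun a b => ?_⟩
  · rw [contDiff_iff_contDiffAt]
    intro z
    have : ContDiff ℝ (⊤ : ℕ∞) (fun z : ℝ × ℝ => ww e y z.1 z.2) := by
      unfold ww TT; fun_prop
    exact (hg _ (he.trans_le (ww_ge e y z.1 z.2))).comp z this.contDiffAt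
  · have : θ + 2*π - y.2 = (θ - y.2) + 2*π := by ring
    simp only [ww, TT]
    rw [this, cos_add_two_pi]
  · simp [ww, TT]
  · simp [ww, TT]

lemma ww_log_nice {e : ℝ} (he : 0 < e) (y : ℝ × ℝ) : Nice (fun r θ => Real.log (ww e y r θ)) :=
  nice_comp_ww he y (fun _ ht => contDiffAt_log.2 ht.ne')

lemma ww_sqrt_nice {e : ℝ} (he : 0 < e) (y : ℝ × ℝ) : Nice (fun r θ => Real.sqrt (ww e y r θ)) :=
  nice_comp_ww he y (fun _ ht => contDiffAt_sqrt ht.ne')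

lemma ww_cont (e : ℝ) (y : ℝ × ℝ) : Continuous (fun z : ℝ × ℝ => ww e y z.1 z.2) := by
  unfold ww TT; fun_prop

lemma lap_log {e : ℝ} (he : 0 < e) (y : ℝ × ℝ) (r θ : ℝ) (hr : sin r ≠ 0) :
    sphLap (fun r θ => Real.log (ww e y r θ)) r θ = e * (2 + e) / ww e y r θ ^ 2 - 1 := by
  have hd : ∀ t : ℝ, HasDerivAt (fun t => 1 + e - t) (-1) t := fun t =>
    (hasDerivAt_id t).const_sub (1 + e)
  have := lap_comp y (fun t => Real.log (1 + e - t)) (fun t => -1 / (1 + e - t))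
    (fun t => -1 / (1 + e - t)^2) (fun t ht => (hd t).log (by linarith))
    (fun t ht => by
      have h0 : 1 + e - t ≠ 0 := by linarith
      refine ((hasDerivAt_const t (-1:ℝ)).div (hd t) h0).congr_deriv ?_
      simp) r θ hr
  have hw : (0:ℝ) < ww e y r θ := he.trans_le (ww_ge e y r θ)
  unfold ww at hw ⊢
  rw [this]
  generalize TT y r θ = t at *
  field_simp
  ring

lemma lap_sqrt {e : ℝ} (he : 0 < e) (y : ℝ × ℝ) (r θ : ℝ) (hr : sin r ≠ 0) :
    (2 / Real.sqrt (ww e y r θ) - 3 * Real.sqrt (2 + e)) / 4 ≤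
      sphLap (fun r θ => Real.sqrt (ww e y r θ)) r θ := by
  have hd : ∀ t : ℝ, HasDerivAt (fun t => 1 + e - t) (-1) t := fun t =>
    (hasDerivAt_id t).const_sub (1 + e)
  have := lap_comp y (fun t => Real.sqrt (1 + e - t)) (fun t => -1 / (2 * Real.sqrt (1 + e - t)))
    (fun t => -1 / (4 * Real.sqrt (1 + e - t) ^ 3)) (fun t ht => (hd t).sqrt (by linarith))
    (fun t ht => by
      have h0 : 0 < 1 + e - t := by linarith
      have hs := sqrt_pos.2 h0
      refine ((hasDerivAt_const t (-1:ℝ)).div (((hd t).sqrt h0.ne').const_mul 2)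
        (by positivity)).congr_deriv ?_
      field_simp
      ring) r θ hr
  have hw : (0:ℝ) < ww e y r θ := he.trans_le (ww_ge e y r θ)
  have hw2 := ww_le e y r θ
  have hle := sqrt_le_sqrt hw2
  have hT := TT_le y r θ
  have hT' := TT_ge y r θ
  have hs := sqrt_pos.2 hw
  have hsq := sq_sqrt hw.le
  unfold ww at *
  rw [this]
  generalize TT y r θ = t at *
  set s := Real.sqrt (1 + e - t)
  have ht : t = 1 + e - s^2 := by linarith
  calc _ ≤ (2 / s - 3 * s) / 4 := by gcongr
    _ ≤ _ := by
      rw [ht]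
      have hes : e ≤ s^2 := by linarith
      have hes2 : s^2 ≤ 2 + e := by linarith
      have : -1 / (4 * s ^ 3) * (1 - (1 + e - s ^ 2) ^ 2) - 2 * (1 + e - s ^ 2) * (-1 / (2 * s)) -
        (2 / s - 3 * s) / 4 = (2 * e * s^2 + e * (2 + e)) / (4 * s^3) := by
        field_simp
        ring
      have h2 : 0 ≤ (2 * e * s^2 + e * (2 + e)) / (4 * s^3) := by positivity
      linarith

lemma int_P {e : ℝ} (he : 0 < e) (y : ℝ × ℝ) :
    ∫ z, e * (2 + e) / ww e y z.1 z.2 ^ 2 ∂sg = 4*π := by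
  have h := green_one (ww_log_nice he y)
  rw [integral_congr_ae (sg_ae fun z hz => lap_log he y z.1 z.2 (Om_sin hz).ne')] at h
  have hc : Continuous (fun z : ℝ × ℝ => e * (2 + e) / ww e y z.1 z.2 ^ 2) :=
    continuous_const.div ((ww_cont e y).pow 2)
      (fun z => (pow_pos (he.trans_le (ww_ge e y z.1 z.2)) 2).ne')
  rw [MeasureTheory.integral_sub (adm_cont (G := fun r θ => e * (2 + e) / ww e y r θ ^ 2) hc).int
    (integrable_const _), sg_one] at h
  linarith

lemma inv_sqrt_cont {e : ℝ} (he : 0 < e) (y : ℝ × ℝ) :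
    Continuous (fun z : ℝ × ℝ => 1 / Real.sqrt (ww e y z.1 z.2)) :=
  continuous_const.div (ww_cont e y).sqrt
      (fun z => (sqrt_pos.2 (he.trans_le (ww_ge e y z.1 z.2))).ne')

lemma int_sqrt {e : ℝ} (he : 0 < e) (y : ℝ × ℝ) :
    ∫ z, 1 / Real.sqrt (ww e y z.1 z.2) ∂sg ≤ 4*π * (3/2 * Real.sqrt (2 + e)) := by
  have h := green_one (ww_sqrt_nice he y)
  have i1 := (adm_cont (G := fun r θ => 1 / Real.sqrt (ww e y r θ)) (inv_sqrt_cont he y)).int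
  have : ∫ z, (1/2 * (1 / Real.sqrt (ww e y z.1 z.2)) - 3/4 * Real.sqrt (2 + e) * 1) ∂sg ≤ 0 := by
    rw [← h]
    refine integral_mono_ae ((i1.const_mul _).sub (integrable_const _))
      (lap_adm (ww_sqrt_nice he y)).int
      (sg_ae fun z hz => le_trans (le_of_eq ?_) (lap_sqrt he y z.1 z.2 (Om_sin hz).ne'))
    ring
  rw [MeasureTheory.integral_sub (i1.const_mul _) (integrable_const _), MeasureTheory.integral_const_mul, MeasureTheory.integral_const_mul,
    sg_one] at this
  linarith

lemma eq_of_TT {F : ℝ → ℝ → ℝ} (h : Nice F) {y z : ℝ × ℝ}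
    (hy : y ∈ Set.Icc 0 π ×ˢ Set.Icc 0 (2*π)) (hz : z ∈ Set.Icc 0 π ×ˢ Set.Icc 0 (2*π))
    (hT : 1 - TT y z.1 z.2 = 0) : F y.1 y.2 = F z.1 z.2 := by
  rw [TT_one_sub] at hT
  have hp := pi_pos
  have s1 := sin_nonneg_of_mem_Icc hy.1
  have s2 := sin_nonneg_of_mem_Icc hz.1
  have c1 := cos_le_one (z.1 - y.1)
  have c2 := cos_le_one (z.2 - y.2)
  have hm : 0 ≤ sin z.1 * sin y.1 * (1 - cos (z.2 - y.2)) :=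
    mul_nonneg (mul_nonneg s2 s1) (by linarith)
  have a1 : cos (z.1 - y.1) = 1 := by linarith
  have a2 : sin z.1 * sin y.1 * (1 - cos (z.2 - y.2)) = 0 := by linarith
  have hzy : z.1 = y.1 := by
    have := (cos_eq_one_iff_of_lt_of_lt (by linarith [hy.1.2, hz.1.1]) (by linarith [hy.1.1, hz.1.2])).1 a1
    linarith
  rw [hzy] at a2 ⊢
  rcases mul_eq_zero.1 a2 with h1 | h1
  · have hs : sin y.1 = 0 := by simpa using h1
    rcases hy.1.1.eq_or_lt with h0 | h0
    · rw [← h0]; exact h.pole0 _ _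
    · rcases hy.1.2.eq_or_lt with h2 | h2
      · rw [h2]; exact h.polepi _ _
      · exact absurd hs (sin_pos_of_mem_Ioo ⟨h0, h2⟩).ne'
  · have : cos (z.2 - y.2) = 1 := by linarith
    obtain ⟨n, hn⟩ := (cos_eq_one_iff _).1 this
    have : z.2 = y.2 + n * (2*π) := by linarith
    rw [this, (h.per y.1).int_mul n]

lemma cont_compare {F : ℝ → ℝ → ℝ} (h : Nice F) {d : ℝ} (hd : 0 < d) :
    ∃ C, 0 ≤ C ∧ ∀ y ∈ Om, ∀ z ∈ Om, F y.1 y.2 ≤ F z.1 z.2 + d + C * (1 - TT y z.1 z.2) := by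
  have cF := Smooth2.cont h.smooth
  set Q : Set (ℝ × ℝ) := Set.Icc 0 π ×ˢ Set.Icc 0 (2*π) with hQ
  have kQ : IsCompact Q := isCompact_Icc.prod isCompact_Icc
  set H : (ℝ × ℝ) × (ℝ × ℝ) → ℝ := fun x => F x.1.1 x.1.2 - F x.2.1 x.2.2 - d with hH
  have cH : Continuous H := by
    have a1 := cF.comp (continuous_fst (X := ℝ × ℝ) (Y := ℝ × ℝ))
    have a2 := cF.comp (continuous_snd (X := ℝ × ℝ) (Y := ℝ × ℝ))
    exact (a1.sub a2).sub continuous_const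
  have cT : Continuous (fun x : (ℝ × ℝ) × (ℝ × ℝ) => 1 - TT x.1 x.2.1 x.2.2) := by
    unfold TT; fun_prop
  set K := (Q ×ˢ Q) ∩ {x | 0 ≤ H x} with hK
  have kK : IsCompact K := (kQ.prod kQ).inter_right (isClosed_le continuous_const cH)
  rcases K.eq_empty_or_nonempty with hE | hN
  · refine ⟨0, le_rfl, fun y hy z hz => ?_⟩
    by_contra hc
    have : (y, z) ∈ K := ⟨⟨Om_sub hy, Om_sub hz⟩, by
      simp only [hH, Set.mem_ofPred_eq]; linarith⟩
    rw [hE] at this; exact this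
  · obtain ⟨x0, hx0, hmin⟩ := kK.exists_isMinOn hN cT.continuousOn
    obtain ⟨x1, hx1, hmax⟩ := kK.exists_isMaxOn hN cH.continuousOn
    set m := 1 - TT x0.1 x0.2.1 x0.2.2 with hm
    have hmpos : 0 < m := by
      have h0 : 0 ≤ m := by have := TT_le x0.1 x0.2.1 x0.2.2; linarith
      refine lt_of_le_of_ne h0 fun he => ?_
      have := eq_of_TT h hx0.1.1 hx0.1.2 he.symm
      have h2 : 0 ≤ H x0 := hx0.2
      simp only [hH] at h2
      linarith
    have hH1 : 0 ≤ H x1 := hx1.2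
    refine ⟨H x1 / m, by positivity, fun y hy z hz => ?_⟩
    have hT := TT_le y z.1 z.2
    by_cases hc : 0 ≤ H (y, z)
    · have hmem : (y, z) ∈ K := ⟨⟨Om_sub hy, Om_sub hz⟩, hc⟩
      have b1 : m ≤ 1 - TT y z.1 z.2 := isMinOn_iff.1 hmin (y, z) hmem
      have b2 : H (y, z) ≤ H x1 := isMaxOn_iff.1 hmax (y, z) hmem
      have : H x1 ≤ H x1 / m * (1 - TT y z.1 z.2) := by
        rw [div_mul_eq_mul_div, le_div_iff₀ hmpos]; gcongr
      have b3 : F y.1 y.2 - F z.1 z.2 - d ≤ H x1 := b2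
      linarith
    · have b3 : F y.1 y.2 - F z.1 z.2 - d < 0 := not_le.1 hc
      have : 0 ≤ H x1 / m * (1 - TT y z.1 z.2) := mul_nonneg (by positivity) (by linarith)
      linarith

lemma P_cont {e : ℝ} (he : 0 < e) (y : ℝ × ℝ) :
    Continuous (fun z : ℝ × ℝ => e * (2 + e) / ww e y z.1 z.2 ^ 2) :=
  continuous_const.div ((ww_cont e y).pow 2)
      (fun z => (pow_pos (he.trans_le (ww_ge e y z.1 z.2)) 2).ne')

lemma approx_id {F : ℝ → ℝ → ℝ} (h : Nice F) {d C e : ℝ} (he : 0 < e) (he1 : e ≤ 1/10)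
    (hC : 0 ≤ C) (hcmp : ∀ y ∈ Om, ∀ z ∈ Om, F y.1 y.2 ≤ F z.1 z.2 + d + C * (1 - TT y z.1 z.2))
    (y : ℝ × ℝ) (hy : y ∈ Om) :
    4*π * F y.1 y.2 ≤ ∫ z, F z.1 z.2 * (e * (2 + e) / ww e y z.1 z.2 ^ 2) ∂sg
      + 4*π * (d + 5 * C * Real.sqrt e) := by
  have cP := P_cont he y
  have cF := Smooth2.cont h.smooth
  have iP := (adm_cont (G := fun r θ => e * (2 + e) / ww e y r θ ^ 2) cP).int
  have iFP := (adm_cont (G := fun r θ => F r θ * (e * (2 + e) / ww e y r θ ^ 2)) (cF.mul cP)).int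
  have iS := (adm_cont (G := fun r θ => 1 / Real.sqrt (ww e y r θ)) (inv_sqrt_cont he y)).int
  have hI : ∫ z, F y.1 y.2 * (e * (2 + e) / ww e y z.1 z.2 ^ 2) ∂sg ≤
      ∫ z, (F z.1 z.2 * (e * (2 + e) / ww e y z.1 z.2 ^ 2) + (d * (e * (2 + e) / ww e y z.1 z.2 ^ 2)
        + C * (Real.sqrt e * (2 + e)) * (1 / Real.sqrt (ww e y z.1 z.2)))) ∂sg := by
    refine integral_mono_ae (iP.const_mul _) (iFP.add ((iP.const_mul _).add (iS.const_mul _)))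
      (sg_ae fun z hz => ?_)
    have h1 := hcmp y hy z hz
    have hw : (0:ℝ) < ww e y z.1 z.2 := he.trans_le (ww_ge e y z.1 z.2)
    have hge := ww_ge e y z.1 z.2
    have h2 : 1 - TT y z.1 z.2 ≤ ww e y z.1 z.2 := by unfold ww; linarith
    simp only
    generalize ww e y z.1 z.2 = w at *
    have hP : 0 ≤ e * (2 + e) / w^2 := by positivity
    have hs := sqrt_pos.2 hw
    have hse := sqrt_pos.2 he
    have hss := sq_sqrt hw.le
    have hsse := sq_sqrt he.le
    have hle := sqrt_le_sqrt hge
    have h3 : F y.1 y.2 ≤ F z.1 z.2 + d + C * w := h1.trans (by gcongr)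
    have h4 : w * (e * (2 + e) / w^2) ≤ (Real.sqrt e * (2 + e)) * (1 / Real.sqrt w) := by
      have e1 : w * (e * (2 + e) / w^2) = e * (2 + e) / w := by field_simp
      rw [e1, mul_one_div, div_le_div_iff₀ hw hs]
      have : e * Real.sqrt w ≤ Real.sqrt e * w := by
        calc e * Real.sqrt w = Real.sqrt e * Real.sqrt e * Real.sqrt w := by rw [← pow_two, hsse]
          _ ≤ Real.sqrt e * Real.sqrt w * Real.sqrt w := by gcongr
          _ = Real.sqrt e * w := by rw [mul_assoc, ← pow_two, hss]
      nlinarith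
    calc F y.1 y.2 * (e * (2 + e) / w^2) ≤ (F z.1 z.2 + d + C * w) * (e * (2 + e) / w^2) := by gcongr
      _ = F z.1 z.2 * (e * (2 + e) / w^2) + (d * (e * (2 + e) / w^2)
        + C * (w * (e * (2 + e) / w^2))) := by ring
      _ ≤ F z.1 z.2 * (e * (2 + e) / w^2) + (d * (e * (2 + e) / w^2)
        + C * ((Real.sqrt e * (2 + e)) * (1 / Real.sqrt w))) := by gcongr
      _ = _ := by ring
  have iR : Integrable (fun z : ℝ × ℝ => d * (e * (2 + e) / ww e y z.1 z.2 ^ 2)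
        + C * (Real.sqrt e * (2 + e)) * (1 / Real.sqrt (ww e y z.1 z.2))) sg :=
    (iP.const_mul _).add (iS.const_mul _)
  rw [MeasureTheory.integral_const_mul, int_P he y,
    MeasureTheory.integral_add iFP iR,
    MeasureTheory.integral_add (iP.const_mul _) (iS.const_mul _), MeasureTheory.integral_const_mul,
    MeasureTheory.integral_const_mul, int_P he y] at hI
  have hS := int_sqrt he y
  have hr : Real.sqrt (2 + e) ≤ 3/2 := by
    rw [sqrt_le_left (by norm_num)]; norm_num; linarith
  have hb : C * (Real.sqrt e * (2 + e)) * ∫ z, 1 / Real.sqrt (ww e y z.1 z.2) ∂sg ≤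
      C * (Real.sqrt e * (21/10)) * (4*π * (3/2 * (3/2))) := by
    have hp := pi_pos
    have : 2 + e ≤ 21/10 := by linarith
    gcongr
    exact hS.trans (by gcongr)
  have hn : 0 ≤ C * Real.sqrt e * (4 * π) := by have := pi_pos; positivity
  nlinarith

lemma PF_le {F : ℝ → ℝ → ℝ} (h : Nice F) (hpos : ∀ r θ, 0 < F r θ) {e : ℝ} (he : 0 < e)
    (y : ℝ × ℝ) :
    ∫ z, F z.1 z.2 * (e * (2 + e) / ww e y z.1 z.2 ^ 2) ∂sg ≤
      ∫ z, (1 + Real.log (2 + e) - Real.log (ww e y z.1 z.2)) * (F z.1 z.2 - sphLap F z.1 z.2) ∂sg := by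
  have cF := Smooth2.cont h.smooth
  have iF := (adm_cont cF).int
  have iL := (lap_adm h).int
  have nl := ww_log_nice he y
  have cl := Smooth2.cont nl.smooth
  have ilF := (adm_cont (G := fun r θ => Real.log (ww e y r θ) * F r θ) (cl.mul cF)).int
  have ilL := ((lap_adm h).mul_cont (W := fun r θ => Real.log (ww e y r θ)) cl).int
  have iFP := (adm_cont (G := fun r θ => F r θ * (e * (2 + e) / ww e y r θ ^ 2))
    (cF.mul (P_cont he y))).int
  have g := green_symm h nl
  have g' : ∫ z, F z.1 z.2 * sphLap (fun r θ => Real.log (ww e y r θ)) z.1 z.2 ∂sg =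
      ∫ z, (F z.1 z.2 * (e * (2 + e) / ww e y z.1 z.2 ^ 2) - F z.1 z.2) ∂sg := by
    refine integral_congr_ae (sg_ae fun z hz => ?_)
    simp only
    rw [lap_log he y z.1 z.2 (Om_sin hz).ne']; ring
  rw [g', MeasureTheory.integral_sub iFP iF] at g
  have h1 := green_one h
  have e1 : ∫ z, (1 + Real.log (2 + e) - Real.log (ww e y z.1 z.2)) * (F z.1 z.2 - sphLap F z.1 z.2) ∂sg
      = ∫ z, (((1 + Real.log (2 + e)) * F z.1 z.2 - (1 + Real.log (2 + e)) * sphLap F z.1 z.2)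
        - (Real.log (ww e y z.1 z.2) * F z.1 z.2 - Real.log (ww e y z.1 z.2) * sphLap F z.1 z.2)) ∂sg := by
    congr 1; funext z; ring
  have hm : ∫ z, Real.log (ww e y z.1 z.2) * F z.1 z.2 ∂sg ≤ ∫ z, Real.log (2 + e) * F z.1 z.2 ∂sg := by
    refine integral_mono ilF (iF.const_mul _) fun z => ?_
    have hw : (0:ℝ) < ww e y z.1 z.2 := he.trans_le (ww_ge e y z.1 z.2)
    exact mul_le_mul_of_nonneg_right (log_le_log hw (ww_le e y z.1 z.2)) (hpos _ _).le
  rw [MeasureTheory.integral_const_mul] at hm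
  have iA : Integrable (fun z : ℝ × ℝ => (1 + Real.log (2 + e)) * F z.1 z.2
      - (1 + Real.log (2 + e)) * sphLap F z.1 z.2) sg := (iF.const_mul _).sub (iL.const_mul _)
  have iB : Integrable (fun z : ℝ × ℝ => Real.log (ww e y z.1 z.2) * F z.1 z.2
      - Real.log (ww e y z.1 z.2) * sphLap F z.1 z.2) sg := ilF.sub ilL
  rw [e1, MeasureTheory.integral_sub iA iB,
    MeasureTheory.integral_sub (iF.const_mul _) (iL.const_mul _),
    MeasureTheory.integral_sub ilF ilL, MeasureTheory.integral_const_mul,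
    MeasureTheory.integral_const_mul, h1]
  linarith

/-- Jensen for the exponential. -/
lemma jensen {k m : ℝ × ℝ → ℝ} {S : ℝ} (hS : 0 < S) (hm : ∀ᵐ z ∂sg, 0 ≤ m z)
    (im : Integrable m sg) (ik : Integrable (fun z => k z * m z) sg)
    (ie : Integrable (fun z => exp (k z) * m z) sg) (hmS : ∫ z, m z ∂sg = S) :
    exp ((∫ z, k z * m z ∂sg) / S) ≤ (∫ z, exp (k z) * m z ∂sg) / S := by
  set a := (∫ z, k z * m z ∂sg) / S with ha
  have ha' : ∫ z, k z * m z ∂sg = a * S := by rw [ha]; field_simp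
  rw [le_div_iff₀ hS]
  have : ∫ z, (exp a * ((1 - a) * m z + k z * m z)) ∂sg ≤ ∫ z, exp (k z) * m z ∂sg := by
    refine integral_mono_ae (((im.const_mul _).add ik).const_mul _) ie ?_
    filter_upwards [hm] with z hz
    have h1 := add_one_le_exp (k z - a)
    have h2 : exp (k z) = exp a * exp (k z - a) := by rw [← exp_add]; congr 1; ring
    rw [h2]
    calc exp a * ((1 - a) * m z + k z * m z) = exp a * (k z - a + 1) * m z := by ring
      _ ≤ _ := by gcongr
  rw [MeasureTheory.integral_const_mul, MeasureTheory.integral_add (im.const_mul _) ik,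
    MeasureTheory.integral_const_mul, hmS, ha'] at this
  linarith

lemma fubini_part {m : ℝ × ℝ → ℝ} (im : Integrable m sg) (hm : ∀ᵐ z ∂sg, 0 ≤ m z)
    {e : ℝ} (he : 0 < e) :
    Integrable (fun y => ∫ z, (1 / Real.sqrt (ww e y z.1 z.2)) * m z ∂sg) sg ∧
    ∫ y, ∫ z, (1 / Real.sqrt (ww e y z.1 z.2)) * m z ∂sg ∂sg ≤
      4*π * (3/2 * Real.sqrt (2 + e)) * ∫ z, m z ∂sg := by
  have cK : Continuous (fun x : (ℝ × ℝ) × (ℝ × ℝ) => 1 / Real.sqrt (ww e x.1 x.2.1 x.2.2)) := by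
    refine continuous_const.div ?_
      (fun z => (sqrt_pos.2 (he.trans_le (ww_ge e _ _ _))).ne')
    refine Continuous.sqrt ?_
    unfold ww TT; fun_prop
  have hI : Integrable (fun x : (ℝ × ℝ) × (ℝ × ℝ) =>
      (1 / Real.sqrt (ww e x.1 x.2.1 x.2.2)) * m x.2) (sg.prod sg) := by
    refine (im.comp_snd sg).bdd_mul (c := 1 / Real.sqrt e) cK.aestronglyMeasurable
      (ae_of_all _ fun x => ?_)
    have hse := sqrt_pos.2 he
    have hle := sqrt_le_sqrt (ww_ge e x.1 x.2.1 x.2.2)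
    rw [norm_of_nonneg (by positivity)]
    gcongr
  refine ⟨hI.integral_prod_left, ?_⟩
  rw [integral_integral_swap hI, ← MeasureTheory.integral_const_mul]
  refine integral_mono_ae hI.integral_prod_right (im.const_mul _) ?_
  filter_upwards [hm] with z hz
  rw [MeasureTheory.integral_mul_const]
  refine mul_le_mul_of_nonneg_right ?_ hz
  simp only [ww_symm e _ z]
  exact int_sqrt he z

lemma exp_const : (315/100 : ℝ) ≤ exp (6/5) := by
  have h := quadratic_le_exp_of_nonneg (x := 3/10) (by norm_num)
  have h2 : exp (6/5 : ℝ) = exp (3/10) ^ 4 := by rw [← exp_nat_mul]; norm_num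
  rw [h2]
  calc (315/100 : ℝ) ≤ (1 + 3/10 + (3/10)^2/2)^4 := by norm_num
    _ ≤ _ := by gcongr

lemma main_exp {F : ℝ → ℝ → ℝ} (h : Nice F) (hpos : ∀ r θ, 0 < F r θ)
    (hlap : ∀ r ∈ Set.Ioo (0:ℝ) π, ∀ θ, sphLap F r θ ≤ F r θ) {S : ℝ} (hS : 0 < S)
    (hSF : ∫ z, F z.1 z.2 ∂sg = S) :
    ∫ z, exp (2*π/S * F z.1 z.2) ∂sg ≤ 4*π * exp (9/5) := by
  have hp := pi_pos
  have cF := Smooth2.cont h.smooth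
  have iF := (adm_cont cF).int
  have iL := (lap_adm h).int
  obtain ⟨C, hC, hcmp⟩ := cont_compare h (d := S / (40*π)) (by positivity)
  obtain ⟨e, he, he1, he2⟩ : ∃ e : ℝ, 0 < e ∧ e ≤ 1/10 ∧ 5 * C * Real.sqrt e ≤ S / (40*π) := by
    refine ⟨min (1/10) ((S / (200*π*(C+1)))^2), by positivity, min_le_left _ _, ?_⟩
    have : Real.sqrt (min (1/10) ((S / (200*π*(C+1)))^2)) ≤ S / (200*π*(C+1)) := by
      rw [sqrt_le_left (by positivity)]; exact min_le_right _ _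
    calc _ ≤ 5 * C * (S / (200*π*(C+1))) := by gcongr
      _ = S / (40*π) * (C / (C+1)) := by field_simp; try ring
      _ ≤ S / (40*π) * 1 := by
        gcongr
        rw [div_le_one (by positivity)]; linarith
      _ = _ := mul_one _
  set m : ℝ × ℝ → ℝ := fun z => F z.1 z.2 - sphLap F z.1 z.2 with hm
  have im : Integrable m sg := iF.sub iL
  have mn : ∀ᵐ z ∂sg, 0 ≤ m z := sg_ae fun z hz => by
    have := hlap z.1 hz.1 z.2
    simp only [hm]; linarith
  have mS : ∫ z, m z ∂sg = S := by
    simp only [hm]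
    rw [MeasureTheory.integral_sub iF iL, green_one h, hSF, sub_zero]
  obtain ⟨fI, fB⟩ := fubini_part im mn he
  have hpt : ∀ y ∈ Om, exp (2*π/S * F y.1 y.2) ≤
      (exp (3/5) * Real.sqrt (2 + e) / S) * ∫ z, (1 / Real.sqrt (ww e y z.1 z.2)) * m z ∂sg := by
    intro y hy
    have a1 := approx_id h he he1 hC hcmp y hy
    have a2 := PF_le h hpos he y
    have am : Adm (fun r θ => F r θ - sphLap F r θ) := by
      obtain ⟨c1, C1, b1⟩ := adm_cont cF
      obtain ⟨c2, C2, b2⟩ := lap_adm h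
      refine ⟨c1.sub c2, C1 + C2, fun z hz => ?_⟩
      rw [sub_mul]
      exact (abs_sub _ _).trans (add_le_add (b1 z hz) (b2 z hz))
    have hex : ∀ z : ℝ × ℝ, exp ((1 + Real.log (2 + e) - Real.log (ww e y z.1 z.2)) / 2) =
        exp (1/2) * Real.sqrt (2 + e) * (1 / Real.sqrt (ww e y z.1 z.2)) := by
      intro z
      have hw : (0:ℝ) < ww e y z.1 z.2 := he.trans_le (ww_ge e y z.1 z.2)
      have e1 : ∀ x : ℝ, 0 < x → exp (Real.log x / 2) = Real.sqrt x := by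
        intro x hx
        rw [sqrt_eq_rpow, rpow_def_of_pos hx]; congr 1; ring
      rw [sub_div, add_div, exp_sub, exp_add, e1 _ hw, e1 _ (by positivity), mul_one_div]
    have ck : Continuous (fun z : ℝ × ℝ => (1 + Real.log (2 + e) - Real.log (ww e y z.1 z.2)) / 2) :=
      (continuous_const.sub (Smooth2.cont (ww_log_nice he y).smooth)).div_const 2
    have j := jensen (k := fun z => (1 + Real.log (2 + e) - Real.log (ww e y z.1 z.2)) / 2)
      (m := m) hS mn im
      (am.mul_cont (W := fun r θ => (1 + Real.log (2 + e) - Real.log (ww e y r θ)) / 2) ck).int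
      (am.mul_cont (W := fun r θ => exp ((1 + Real.log (2 + e) - Real.log (ww e y r θ)) / 2)) ck.rexp).int
      mS
    simp only [hex] at j
    have e2 : ∫ z, (1 + Real.log (2 + e) - Real.log (ww e y z.1 z.2)) / 2 * m z ∂sg =
        (∫ z, (1 + Real.log (2 + e) - Real.log (ww e y z.1 z.2)) * m z ∂sg) / 2 := by
      rw [← MeasureTheory.integral_div]; congr 1; funext z; ring
    have e3 : ∫ z, exp (1/2) * Real.sqrt (2 + e) * (1 / Real.sqrt (ww e y z.1 z.2)) * m z ∂sg =
        exp (1/2) * Real.sqrt (2 + e) * ∫ z, (1 / Real.sqrt (ww e y z.1 z.2)) * m z ∂sg := by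
      rw [← MeasureTheory.integral_const_mul]; congr 1; funext z; ring
    rw [e2, e3] at j
    set X := ∫ z, (1 + Real.log (2 + e) - Real.log (ww e y z.1 z.2)) * m z ∂sg with hX
    set Y := ∫ z, (1 / Real.sqrt (ww e y z.1 z.2)) * m z ∂sg with hY
    have hle : 2*π/S * F y.1 y.2 ≤ X / 2 / S + 1/10 := by
      have : 4*π * F y.1 y.2 ≤ X + 4*π * (S/(40*π) + S/(40*π)) := by
        refine a1.trans (add_le_add a2 ?_)
        gcongr
      have h3 : 4*π * (S/(40*π) + S/(40*π)) = S / 5 := by field_simp; try ring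
      rw [h3] at this
      have : 2*π/S * F y.1 y.2 = (4*π * F y.1 y.2) / (2*S) := by field_simp; try ring
      rw [this, div_le_iff₀ (by positivity)]
      have : (X / 2 / S + 1/10) * (2*S) = X + S/5 := by field_simp; try ring
      rw [this]; assumption
    calc exp (2*π/S * F y.1 y.2) ≤ exp (X / 2 / S + 1/10) := exp_le_exp.2 hle
      _ = exp (1/10) * exp (X / 2 / S) := by rw [exp_add, mul_comm]
      _ ≤ exp (1/10) * (exp (1/2) * Real.sqrt (2 + e) * Y / S) := by gcongr
      _ = (exp (1/10) * exp (1/2)) * Real.sqrt (2 + e) / S * Y := by ring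
      _ = _ := by rw [← exp_add]; norm_num
  have cE : Continuous (fun z : ℝ × ℝ => exp (2*π/S * F z.1 z.2)) := (continuous_const.mul cF).rexp
  have hs2 : Real.sqrt (2+e) * Real.sqrt (2+e) = 2 + e := mul_self_sqrt (by positivity)
  calc ∫ z, exp (2*π/S * F z.1 z.2) ∂sg
      ≤ ∫ y, (exp (3/5) * Real.sqrt (2 + e) / S) *
        ∫ z, (1 / Real.sqrt (ww e y z.1 z.2)) * m z ∂sg ∂sg :=
        integral_mono_ae (adm_cont (G := fun r θ => exp (2*π/S * F r θ)) cE).int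
          (fI.const_mul _) (sg_ae hpt)
    _ ≤ (exp (3/5) * Real.sqrt (2 + e) / S) * (4*π * (3/2 * Real.sqrt (2 + e)) * S) := by
        rw [MeasureTheory.integral_const_mul]
        rw [mS] at fB
        gcongr
    _ = 4*π * (exp (3/5) * (3/2 * (Real.sqrt (2+e) * Real.sqrt (2+e)))) := by
        field_simp
    _ ≤ 4*π * (exp (3/5) * exp (6/5)) := by
        rw [hs2]
        have := exp_const
        gcongr
        linarith
    _ = _ := by rw [← exp_add]; norm_num

lemma Lq_bound {F : ℝ → ℝ → ℝ} {V : ℝ} (h : Nice F) (hpos : ∀ r θ, 0 < F r θ)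
    (hlap : ∀ r ∈ Set.Ioo (0:ℝ) π, ∀ θ, sphLap F r θ ≤ F r θ)
    (hvol : sphereIntegral F ≤ V/(2*π)) {q : ℝ} (hq : 2 ≤ q) :
    sphereIntegral (fun r θ => |F r θ| ^ q) ≤ 4*π * exp (V*q/(8*π^2) + q^2/4) := by
  have hp := pi_pos
  have cF := Smooth2.cont h.smooth
  have iF := (adm_cont cF).int
  rw [(adm_cont cF).sph] at hvol
  rw [(adm_cont (G := fun r θ => |F r θ| ^ q)
    (cF.abs.rpow_const (fun _ => Or.inr (by linarith)))).sph]
  obtain ⟨S, hSF⟩ : ∃ S, ∫ z, F z.1 z.2 ∂sg = S := ⟨_, rfl⟩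
  have hS : 0 < S := by
    obtain ⟨z0, _, hz0⟩ := (isCompact_Icc.prod isCompact_Icc :
      IsCompact (Set.Icc (0:ℝ) π ×ˢ Set.Icc (0:ℝ) (2*π))).exists_isMinOn
      ⟨(0,0), ⟨⟨le_rfl, hp.le⟩, ⟨le_rfl, by positivity⟩⟩⟩ cF.continuousOn
    have : ∫ _z, F z0.1 z0.2 * 1 ∂sg ≤ ∫ z, F z.1 z.2 ∂sg :=
      integral_mono_ae (integrable_const _) iF (sg_ae fun z hz => by
        simp only [mul_one]; exact hz0 (Om_sub hz))
    rw [MeasureTheory.integral_const_mul, sg_one, hSF] at this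
    have := hpos z0.1 z0.2
    have : 0 < F z0.1 z0.2 * (4*π) := by positivity
    linarith
  rw [hSF] at hvol
  have hE := main_exp h hpos hlap hS hSF
  have cE : Continuous (fun z : ℝ × ℝ => exp (2*π/S * F z.1 z.2)) := (continuous_const.mul cF).rexp
  have iE := (adm_cont (G := fun r θ => exp (2*π/S * F r θ)) cE).int
  have xle : ∀ x : ℝ, x ≤ exp (x - 1) := fun x => by have := add_one_le_exp (x - 1); linarith
  have hq0 : 0 < q := by linarith
  set b := S / (4*π) with hb
  have hb0 : 0 < b := by positivity
  have hbv : b ≤ V/(8*π^2) := by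
    calc b ≤ V/(2*π)/(4*π) := by rw [hb]; gcongr
      _ = _ := by field_simp; try ring
  have hlog8 : (8:ℝ) ≤ exp (21/10) := by
    have h2 : exp (21/10 : ℝ) = exp (7/10) ^ 3 := by rw [← exp_nat_mul]; norm_num
    have h3 : (2:ℝ) ≤ exp (7/10) := by
      have := log_two_lt_d9
      rw [← log_le_iff_le_exp (by norm_num)]; linarith
    rw [h2]
    calc (8:ℝ) = 2^3 := by norm_num
      _ ≤ _ := by gcongr
  have hpt : ∀ z : ℝ × ℝ, |F z.1 z.2| ^ q ≤ 
      exp (q * (V/(8*π^2)) + q^2/4 - 9/5) * exp (2*π/S * F z.1 z.2) := by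
    intro z
    have hF := hpos z.1 z.2
    rw [abs_of_pos hF]
    have h1 : F z.1 z.2 ≤ exp (V/(8*π^2) + q/4 - 9/10 + F z.1 z.2 / (2*q*b)) := by
      have x1 := xle (F z.1 z.2 / (2*q*b))
      rw [div_le_iff₀ (by positivity)] at x1
      have x2 := xle (q/4)
      have x3 := xle b
      have x4 : exp (b - 1) ≤ exp (V/(8*π^2) - 1) := exp_le_exp.2 (by linarith)
      calc F z.1 z.2 ≤ exp (F z.1 z.2 / (2*q*b) - 1) * (2*q*b) := x1
        _ = exp (F z.1 z.2 / (2*q*b) - 1) * (8 * (q/4) * b) := by ring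
        _ ≤ exp (F z.1 z.2 / (2*q*b) - 1) * (exp (21/10) * exp (q/4 - 1) * exp (V/(8*π^2) - 1)) := by
          gcongr
          exact x3.trans x4
        _ = _ := by rw [← exp_add, ← exp_add, ← exp_add]; congr 1; ring
    calc F z.1 z.2 ^ q ≤ (exp (V/(8*π^2) + q/4 - 9/10 + F z.1 z.2 / (2*q*b))) ^ q :=
          rpow_le_rpow hF.le h1 hq0.le
      _ = exp ((V/(8*π^2) + q/4 - 9/10 + F z.1 z.2 / (2*q*b)) * q) := by rw [← exp_mul]
      _ ≤ exp ((q * (V/(8*π^2)) + q^2/4 - 9/5) + 2*π/S * F z.1 z.2) := by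
          rw [exp_le_exp]
          have : F z.1 z.2 / (2*q*b) * q = 2*π/S * F z.1 z.2 := by
            rw [hb]; field_simp; try ring
          rw [add_mul, this]
          nlinarith
      _ = _ := exp_add _ _
  calc _ ≤ ∫ z, exp (q * (V/(8*π^2)) + q^2/4 - 9/5) * exp (2*π/S * F z.1 z.2) ∂sg :=
        integral_mono ((adm_cont (G := fun r θ => |F r θ| ^ q)
          (cF.abs.rpow_const (fun _ => Or.inr (by linarith)))).int) (iE.const_mul _) hpt
    _ ≤ exp (q * (V/(8*π^2)) + q^2/4 - 9/5) * (4*π * exp (9/5)) := by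
        rw [MeasureTheory.integral_const_mul]; gcongr
    _ = 4*π * (exp (q * (V/(8*π^2)) + q^2/4 - 9/5) * exp (9/5)) := by ring
    _ = _ := by
        rw [← exp_add]; congr 2; ring

/-- `W^{1,p}` bound, `1 ≤ p < 2`. If `f > 0` is smooth with `Δf ≤ f` and
`∫_{S²} f ≤ V/(2π)`, then `‖∇f‖_{L^p} ≤ ‖∇ ln f‖_{L²} · ‖f‖_{L^{2p/(2−p)}}`, and both factors
are bounded explicitly in terms of `V` and `p`:  `‖∇ ln f‖_{L²} ≤ √(4π)` and
`‖f‖_{L^{2p/(2−p)}} ≤ (4π exp(Vq/(8π²) + q²/4))^{1/q}` with `q = 2p/(2−p)`. -/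
theorem W1p_bound (F : ℝ → ℝ → ℝ) (V : ℝ) (hV : 0 < V)
    (hsmooth : ContDiff ℝ (⊤ : ℕ∞) (Function.uncurry F))
    (hper : ∀ r, Function.Periodic (F r) (2*π))
    (hpole₀ : ∀ θ₁ θ₂, F 0 θ₁ = F 0 θ₂)
    (hpoleπ : ∀ θ₁ θ₂, F π θ₁ = F π θ₂)
    (hpos : ∀ r θ, 0 < F r θ)
    (hlap : ∀ r ∈ Set.Ioo (0:ℝ) π, ∀ θ, sphLap F r θ ≤ F r θ)
    (hvol : sphereIntegral F ≤ V/(2*π)) :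
    ∀ p : ℝ, 1 ≤ p → p < 2 →
      (sphereIntegral (fun r θ => Real.sqrt (gradSq F r θ) ^ p)) ^ (1/p)
          ≤ Real.sqrt (sphereIntegral (gradSq (fun r θ => Real.log (F r θ))))
            * sphereLpNorm F (2*p/(2-p))
        ∧ Real.sqrt (sphereIntegral (gradSq (fun r θ => Real.log (F r θ)))) ≤ Real.sqrt (4*π)
        ∧ sphereLpNorm F (2*p/(2-p))
            ≤ (4*π * Real.exp (V*(2*p/(2-p))/(8*π^2) + (2*p/(2-p))^2/4)) ^ ((2-p)/(2*p)) := by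
  intro p hp1 hp2
  have h : Nice F := ⟨hsmooth, hper, hpole₀, hpoleπ⟩
  have hp0 : 0 < p := by linarith
  have h2p : 0 < 2 - p := by linarith
  refine ⟨holder_part h hpos hp1 hp2, Real.sqrt_le_sqrt (gradlog_bound h hpos hlap), ?_⟩
  have hq : 2 ≤ 2*p/(2-p) := by
    rw [le_div_iff₀ h2p]; linarith
  have hB := Lq_bound h hpos hlap hvol hq
  unfold sphereLpNorm
  have e : 1 / (2*p/(2-p)) = (2-p)/(2*p) := by rw [one_div_div]
  rw [e]
  refine Real.rpow_le_rpow ?_ hB (by positivity)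
  have cF := Smooth2.cont h.smooth
  rw [(adm_cont (G := fun r θ => |F r θ| ^ (2*p/(2-p)))
    (cF.abs.rpow_const (fun _ => Or.inr (by linarith)))).sph]
  exact integral_nonneg fun z => by positivity
end
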